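/- arXiv:2407.06155 — 3 statements merged into one kernel-verified Lean document; each statement's English description precedes it below -/
import Mathlib

section
/- Let G be a natural unit interval graph on {1,…,n} and let κ_G be the greedy proper colouring defined by κ_G(1) = 1 and κ_G(j) = the smallest positive integer not among {κ_G(i) : i < j and ij ∈ E}. Let μ_G be the type of κ_G, i.e. (μ_G)_i = #{v : κ_G(v) = i}. Then: (1) μ_G is a partition (weakly decreasing); (2) the coefficients c_{λ_G} and c_{λ_G}(q) are nonzero, where λ_G = μ_G' is the conjugate of μ_G; and (3) if c_λ ≠ 0 then λ ⊵ λ_G in dominance order, and likewise c_λ(q) ≠ 0 implies λ ⊵ λ_G. -/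
open Finset MvPolynomial
open scoped Classical

noncomputable section

/-- `κ` is a proper colouring of `G`. -/
def IsProper {n N : ℕ} (G : SimpleGraph (Fin n)) (κ : Fin n → Fin N) : Prop :=
  ∀ i j, G.Adj i j → κ i ≠ κ j

/-- The chromatic symmetric function of `G`, truncated to `N` variables. -/
def chromSym (n N : ℕ) (G : SimpleGraph (Fin n)) : MvPolynomial (Fin N) ℤ :=
  ∑ κ : Fin n → Fin N, if IsProper G κ then ∏ i, X (κ i) else 0

/-- The number of ascents of a colouring. -/
def ascNum {n N : ℕ} (G : SimpleGraph (Fin n)) (κ : Fin n → Fin N) : ℕ :=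
  ((Finset.univ : Finset (Fin n × Fin n)).filter fun p =>
    G.Adj p.1 p.2 ∧ p.1 < p.2 ∧ κ p.1 < κ p.2).card

/-- The chromatic quasisymmetric function of `G`, with coefficients in `ℤ[q]`,
truncated to `N` variables. -/
def chromQSym (n N : ℕ) (G : SimpleGraph (Fin n)) :
    MvPolynomial (Fin N) (Polynomial ℤ) :=
  ∑ κ : Fin n → Fin N, if IsProper G κ then
    C (Polynomial.X ^ ascNum G κ) * ∏ i, X (κ i) else 0

/-- `e_λ`, the product of elementary symmetric polynomials over the parts of `λ`. -/
def eProd (N : ℕ) (R : Type) [CommSemiring R] {n : ℕ} (p : Nat.Partition n) :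
    MvPolynomial (Fin N) R :=
  (p.parts.map fun k => esymm (Fin N) R k).prod

/-- The number of parts of a partition, i.e. `λ'_1`. -/
def numParts {n : ℕ} (p : Nat.Partition n) : ℕ := Multiset.card p.parts

/-- The largest part `λ_1` of a partition. -/
def maxPart {n : ℕ} (p : Nat.Partition n) : ℕ := p.parts.sup

/-- `λ'_1 + ⋯ + λ'_k`, the number of cells in the first `k` columns of `λ`. -/
def conjSum {n : ℕ} (p : Nat.Partition n) (k : ℕ) : ℕ :=
  (p.parts.map fun a => min a k).sum

/-- `λ_1 + ⋯ + λ_k`, the number of cells in the first `k` rows of `λ`. -/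
def partSum {n : ℕ} (p : Nat.Partition n) (k : ℕ) : ℕ :=
  ∑ j ∈ Finset.Icc 1 n, min (Multiset.card (p.parts.filter fun a => j ≤ a)) k

/-- `s` is an independent set of vertices of `G`. -/
def IsIndepFinset {V : Type} (G : SimpleGraph V) (s : Finset V) : Prop :=
  ∀ i ∈ s, ∀ j ∈ s, ¬ G.Adj i j

/-- `s` is a clique of `G`. -/
def IsCliqueFinset {V : Type} (G : SimpleGraph V) (s : Finset V) : Prop :=
  ∀ i ∈ s, ∀ j ∈ s, i ≠ j → G.Adj i j

/-- The independence number `α(G)`. -/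
def indepNum {n : ℕ} (G : SimpleGraph (Fin n)) : ℕ :=
  sSup {k | ∃ s : Finset (Fin n), IsIndepFinset G s ∧ s.card = k}

/-- The clique number `ω(G)`. -/
def cliqueNum {n : ℕ} (G : SimpleGraph (Fin n)) : ℕ :=
  sSup {k | ∃ s : Finset (Fin n), IsCliqueFinset G s ∧ s.card = k}

/-- `α_k(G)`: the maximum number of vertices in an independent partition
with `k` blocks. -/
def alphaK {n : ℕ} (G : SimpleGraph (Fin n)) (k : ℕ) : ℕ :=
  sSup {m | ∃ B : Fin k → Finset (Fin n),
    (∀ i j, i ≠ j → Disjoint (B i) (B j)) ∧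
    (∀ i, IsIndepFinset G (B i)) ∧ m = ∑ i, (B i).card}

/-- `ω_k(G)`: the maximum number of vertices in a clique partition
with `k` blocks. -/
def omegaK {n : ℕ} (G : SimpleGraph (Fin n)) (k : ℕ) : ℕ :=
  sSup {m | ∃ B : Fin k → Finset (Fin n),
    (∀ i j, i ≠ j → Disjoint (B i) (B j)) ∧
    (∀ i, IsCliqueFinset G (B i)) ∧ m = ∑ i, (B i).card}

/-- `G` is a natural unit interval graph. -/
def IsNUIG {n : ℕ} (G : SimpleGraph (Fin n)) : Prop :=
  ∀ i j k : Fin n, i < j → j < k → G.Adj i k → G.Adj i j ∧ G.Adj j k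

/-- The `q`-integer `[k]_q = 1 + q + ⋯ + q^(k-1)` in `ℤ[q]`. -/
def qInt (k : ℕ) : Polynomial ℤ := ∑ i ∈ Finset.range k, Polynomial.X ^ i

/-- The `q`-factorial `[k]_q!` in `ℤ[q]`. -/
def qFact : ℕ → Polynomial ℤ
  | 0 => 1
  | k + 1 => qInt (k + 1) * qFact k

end

/-- The greedy proper colouring `κ_G`: each vertex in turn gets the smallest
positive colour not used on its smaller neighbours. -/
noncomputable def greedy {n : ℕ} (G : SimpleGraph (Fin n)) : Fin n → ℕ
  | j => sInf {c : ℕ | 1 ≤ c ∧ ∀ i : Fin n, ∀ _ : i < j, G.Adj i j → greedy G i ≠ c}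
termination_by j => j.1
decreasing_by exact ‹_ < j›

/-- `(μ_G)_i`: the number of vertices receiving colour `i` under `κ_G`. -/
noncomputable def typeCount {n : ℕ} (G : SimpleGraph (Fin n)) (i : ℕ) : ℕ :=
  (Finset.univ.filter fun v : Fin n => greedy G v = i).card


namespace Stmt10

/-! ### The greedy colouring -/

theorem greedy_set_nonempty {n : ℕ} (G : SimpleGraph (Fin n)) (j : Fin n) :
    {c : ℕ | 1 ≤ c ∧ ∀ i : Fin n, ∀ _ : i < j, G.Adj i j → greedy G i ≠ c}.Nonempty := by
  refine ⟨(∑ i, greedy G i) + 1, by omega, fun i _ _ h => ?_⟩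
  have := Finset.single_le_sum (f := greedy G) (fun _ _ => Nat.zero_le _) (Finset.mem_univ i)
  omega

theorem greedy_spec {n : ℕ} (G : SimpleGraph (Fin n)) (j : Fin n) :
    1 ≤ greedy G j ∧ ∀ i : Fin n, i < j → G.Adj i j → greedy G i ≠ greedy G j := by
  have h := Nat.sInf_mem (greedy_set_nonempty G j)
  rw [← greedy] at h
  exact h

theorem greedy_min {n : ℕ} (G : SimpleGraph (Fin n)) (j : Fin n) (c : ℕ) (h1 : 1 ≤ c)
    (hc : c < greedy G j) : ∃ i : Fin n, i < j ∧ G.Adj i j ∧ greedy G i = c := by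
  by_contra! hcon
  have : greedy G j ≤ c := by
    rw [greedy]
    exact Nat.sInf_le ⟨h1, fun i h1 h2 => hcon i h1 h2⟩
  omega

theorem greedy_ne {n : ℕ} (G : SimpleGraph (Fin n)) (i j : Fin n) (h : G.Adj i j) :
    greedy G i ≠ greedy G j := by
  rcases lt_trichotomy i j with h1 | h1 | h1
  · exact (greedy_spec G j).2 i h1 h
  · subst h1; exact absurd h (G.loopless.irrefl i)
  · exact ((greedy_spec G i).2 j h1 h.symm).symm

theorem greedy_le {n : ℕ} (G : SimpleGraph (Fin n)) (j : Fin n) : greedy G j ≤ n := by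
  have hsub : Finset.Icc 1 (greedy G j - 1) ⊆ (Finset.Iio j).image (greedy G) := by
    intro c hc
    rw [Finset.mem_Icc] at hc
    obtain ⟨i, h1, _, h3⟩ := greedy_min G j c hc.1 (by omega)
    exact Finset.mem_image.2 ⟨i, Finset.mem_Iio.2 h1, h3⟩
  have h := (Finset.card_le_card hsub).trans Finset.card_image_le
  simp at h
  have := j.2
  omega

theorem typeCount_anti {n : ℕ} (G : SimpleGraph (Fin n)) (hG : IsNUIG G) (i : ℕ) (hi : 1 ≤ i) :
    typeCount G (i + 1) ≤ typeCount G i := by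
  have hex : ∀ v : Fin n, ∃ u : Fin n, greedy G v = i + 1 →
      u < v ∧ G.Adj u v ∧ greedy G u = i := by
    intro v
    by_cases hv : greedy G v = i + 1
    · obtain ⟨u, hu⟩ := greedy_min G v i hi (by omega)
      exact ⟨u, fun _ => hu⟩
    · exact ⟨v, fun h => absurd h hv⟩
  choose f hf using hex
  unfold typeCount
  refine Finset.card_le_card_of_injOn f ?_ ?_
  · intro v hv
    simp only [Finset.coe_filter, Finset.mem_univ, true_and, Set.mem_ofPred_eq] at hv ⊢
    exact (hf v hv).2.2
  · intro v hv w hw hvw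
    simp only [Finset.coe_filter, Finset.mem_univ, true_and, Set.mem_ofPred_eq] at hv hw
    obtain ⟨a1, a2, a3⟩ := hf v hv
    obtain ⟨b1, b2, b3⟩ := hf w hw
    rcases lt_trichotomy v w with h | h | h
    · rw [← hvw] at b1 b2
      exact absurd (hv.trans hw.symm) (greedy_ne G v w (hG _ _ _ a1 h b2).2)
    · exact h
    · rw [hvw] at a1 a2
      exact absurd (hw.trans hv.symm) (greedy_ne G w v (hG _ _ _ b1 h a2).2)

/-- The greedy colouring covers as many vertices by `k` colours as possible. -/
theorem greedy_max {n : ℕ} (G : SimpleGraph (Fin n)) (hG : IsNUIG G) (k : ℕ)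
    (U : Finset (Fin n))
    (hU : ∀ S ⊆ U, (∀ x ∈ S, ∀ y ∈ S, x < y → G.Adj x y) → S.card ≤ k) :
    ∀ j, j ≤ n → (U.filter fun v => v.val < j).card ≤
      (Finset.univ.filter fun v : Fin n => greedy G v ≤ k ∧ v.val < j).card := by
  intro j
  induction j using Nat.strong_induction_on with
  | _ j ih =>
  intro hj
  rcases j with _ | j
  · simp
  set v : Fin n := ⟨j, by omega⟩ with hv
  by_cases hL : greedy G v ≤ k
  · have h1 : (U.filter fun u => u.val < j + 1) ⊆ insert v (U.filter fun u => u.val < j) := by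
      intro u hu
      simp only [Finset.mem_filter, Finset.mem_insert, Fin.ext_iff, hv] at hu ⊢
      have := hu.1
      by_cases h : u.val = j
      · exact Or.inl h
      · exact Or.inr ⟨this, by omega⟩
    have h2 : insert v (Finset.univ.filter fun u : Fin n => greedy G u ≤ k ∧ u.val < j) ⊆
        (Finset.univ.filter fun u : Fin n => greedy G u ≤ k ∧ u.val < j + 1) := by
      intro u hu
      simp only [Finset.mem_filter, Finset.mem_insert, Finset.mem_univ, true_and] at hu ⊢
      rcases hu with rfl | hu
      · exact ⟨hL, by simp [hv]⟩
      · exact ⟨hu.1, by omega⟩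
    have h3 := Finset.card_le_card h1
    have h4 := Finset.card_le_card h2
    rw [Finset.card_insert_of_notMem (by simp [hv])] at h4
    have h5 := Finset.card_insert_le v (U.filter fun u => u.val < j)
    have := ih j (by omega) (by omega)
    omega
  · push Not at hL
    have hex : ∃ a, a = j ∨ ∃ x : Fin n, x.val = a ∧ x < v ∧ G.Adj x v := ⟨j, Or.inl rfl⟩
    let a := Nat.find hex
    have ha : a = j ∨ ∃ x : Fin n, x.val = a ∧ x < v ∧ G.Adj x v := Nat.find_spec hex
    have haj : a ≤ j := Nat.find_min' hex (Or.inl rfl)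
    have hadj : ∀ x : Fin n, a ≤ x.val → x < v → G.Adj x v := by
      intro x hx hxv
      rcases ha with h | ⟨y, hy, hyv, hadj⟩
      · simp only [Fin.lt_def, hv] at hxv
        omega
      · rcases lt_or_eq_of_le hx with h | h
        · exact (hG y x v (by rw [Fin.lt_def]; omega) hxv hadj).2
        · have : x = y := Fin.ext (by omega)
          rw [this]; exact hadj
    -- the clique
    have hcl : (U.filter fun u => a ≤ u.val ∧ u.val < j + 1).card ≤ k := by
      apply hU _ (Finset.filter_subset _ _)
      intro x hx y hy hxy
      simp only [Finset.mem_filter] at hx hy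
      have hxy' : x.val < y.val := hxy
      have hxv : G.Adj x v := hadj x hx.2.1 (by simp only [Fin.lt_def, hv]; omega)
      by_cases h : y = v
      · rw [h]; exact hxv
      · have hyv : y < v := by
          have : y.val ≠ j := fun h' => h (Fin.ext h')
          simp only [Fin.lt_def, hv]; omega
        exact (hG x y v hxy hyv hxv).1
    have hLk : k ≤ (Finset.univ.filter fun u : Fin n =>
        greedy G u ≤ k ∧ a ≤ u.val ∧ u.val < j + 1).card := by
      have hsub : Finset.Icc 1 k ⊆ (Finset.univ.filter fun u : Fin n =>
          greedy G u ≤ k ∧ a ≤ u.val ∧ u.val < j + 1).image (greedy G) := by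
        intro c hc
        rw [Finset.mem_Icc] at hc
        obtain ⟨i, h1, h2, h3⟩ := greedy_min G v c hc.1 (by omega)
        refine Finset.mem_image.2 ⟨i, ?_, h3⟩
        simp only [Finset.mem_filter, Finset.mem_univ, true_and]
        refine ⟨by omega, Nat.find_min' hex (Or.inr ⟨i, rfl, h1, h2⟩), ?_⟩
        simp only [Fin.lt_def, hv] at h1
        omega
      have h := (Finset.card_le_card hsub).trans Finset.card_image_le
      simpa using h
    have h1 : (U.filter fun u => u.val < j + 1) ⊆
        (U.filter fun u => u.val < a) ∪ (U.filter fun u => a ≤ u.val ∧ u.val < j + 1) := by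
      intro u hu
      simp only [Finset.mem_filter, Finset.mem_union] at hu ⊢
      by_cases h : u.val < a
      · exact Or.inl ⟨hu.1, h⟩
      · exact Or.inr ⟨hu.1, by omega, hu.2⟩
    have h2 : (Finset.univ.filter fun u : Fin n => greedy G u ≤ k ∧ u.val < a) ∪
        (Finset.univ.filter fun u : Fin n => greedy G u ≤ k ∧ a ≤ u.val ∧ u.val < j + 1) ⊆
        (Finset.univ.filter fun u : Fin n => greedy G u ≤ k ∧ u.val < j + 1) := by
      intro u hu
      simp only [Finset.mem_filter, Finset.mem_union, Finset.mem_univ, true_and] at hu ⊢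
      rcases hu with h | h
      · exact ⟨h.1, by omega⟩
      · exact ⟨h.1, by omega⟩
    have h3 := (Finset.card_le_card h1).trans (Finset.card_union_le _ _)
    have h4 := Finset.card_le_card h2
    rw [Finset.card_union_of_disjoint (by
      rw [Finset.disjoint_left]
      intro u hu hu'
      simp only [Finset.mem_filter, Finset.mem_univ, true_and] at hu hu'
      omega)] at h4
    have := ih a (by omega) (by omega)
    omega

theorem card_greedy_le {n : ℕ} (G : SimpleGraph (Fin n)) (k : ℕ) :
    (Finset.univ.filter fun v : Fin n => greedy G v ≤ k).card =
      ∑ i ∈ Finset.Icc 1 k, typeCount G i := by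
  unfold typeCount
  rw [Finset.card_eq_sum_card_fiberwise (f := greedy G) (t := Finset.Icc 1 k)]
  · refine Finset.sum_congr rfl fun i hi => ?_
    rw [Finset.mem_Icc] at hi
    congr 1
    ext v
    simp only [Finset.mem_filter, Finset.mem_univ, true_and]
    omega
  · intro v hv
    simp only [Finset.coe_filter, Finset.mem_univ, true_and, Set.mem_ofPred_eq] at hv
    exact Finset.mem_coe.2 (Finset.mem_Icc.2 ⟨(greedy_spec G v).1, hv⟩)

theorem proper_bound {n N : ℕ} (G : SimpleGraph (Fin n)) (hG : IsNUIG G) (κ : Fin n → Fin N)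
    (hκ : IsProper G κ) (T : Finset (Fin N)) :
    (Finset.univ.filter fun v => κ v ∈ T).card ≤ ∑ i ∈ Finset.Icc 1 T.card, typeCount G i := by
  have h := greedy_max G hG T.card (Finset.univ.filter fun v => κ v ∈ T) ?_ n le_rfl
  · rw [← card_greedy_le]
    simpa using h
  · intro S hS hcl
    refine Finset.card_le_card_of_injOn κ ?_ ?_
    · intro x hx
      have := hS hx
      simpa using this
    · intro x hx y hy hxy
      rcases lt_trichotomy x y with h | h | h
      · exact absurd hxy (hκ _ _ (hcl x hx y hy h))
      · exact h
      · exact absurd hxy.symm (hκ _ _ (hcl y hy x hx h))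

/-! ### Partitions -/

theorem min_sum (s : Multiset ℕ) (k : ℕ) :
    (s.map fun a => min a k).sum =
      ∑ i ∈ Finset.Icc 1 k, Multiset.card (s.filter fun a => i ≤ a) := by
  induction s using Multiset.induction_on with
  | empty => simp
  | cons a s ih =>
    rw [Multiset.map_cons, Multiset.sum_cons, ih]
    have : ∀ i, Multiset.card ((a ::ₘ s).filter fun a => i ≤ a) =
        (if i ≤ a then 1 else 0) + Multiset.card (s.filter fun a => i ≤ a) := by
      intro i
      rw [Multiset.filter_cons, Multiset.card_add]
      split_ifs <;> simp
    rw [Finset.sum_congr rfl fun i _ => this i, Finset.sum_add_distrib]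
    congr 1
    rw [← Finset.card_filter]
    have : (Finset.Icc 1 k).filter (fun i => i ≤ a) = Finset.Icc 1 (min a k) := by
      ext i; simp only [Finset.mem_filter, Finset.mem_Icc]; omega
    rw [this]; simp

theorem part_le {n : ℕ} (p : Nat.Partition n) (a : ℕ) (ha : a ∈ p.parts) : a ≤ n := by
  have := Multiset.single_le_sum (s := p.parts) (fun _ _ => Nat.zero_le _) a ha
  rwa [p.parts_sum] at this

theorem conjSum_large {n : ℕ} (p : Nat.Partition n) (k : ℕ) (hk : n ≤ k) : conjSum p k = n := by
  unfold conjSum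
  rw [Multiset.map_congr (g := id) rfl]
  · simp [p.parts_sum]
  · intro a ha
    have := part_le p a ha
    simp; omega

theorem conjSum_inj {n : ℕ} (p r : Nat.Partition n)
    (h : ∀ k, k ≤ n → conjSum p k = conjSum r k) : p = r := by
  have h' : ∀ k, conjSum p k = conjSum r k := by
    intro k
    rcases le_total k n with hk | hk
    · exact h k hk
    · rw [conjSum_large p k hk, conjSum_large r k hk]
  have hcard : ∀ i, 1 ≤ i → Multiset.card (p.parts.filter fun a => i ≤ a) =
      Multiset.card (r.parts.filter fun a => i ≤ a) := by
    intro i hi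
    obtain ⟨m, rfl⟩ : ∃ m, i = m + 1 := ⟨i - 1, by omega⟩
    have h1 := h' m
    have h2 := h' (m + 1)
    unfold conjSum at h1 h2
    rw [min_sum, min_sum] at h1 h2
    rw [Finset.sum_Icc_succ_top (by omega), Finset.sum_Icc_succ_top (by omega)] at h2
    omega
  have hcount : ∀ (s : Multiset ℕ) (a : ℕ), Multiset.card (s.filter fun b => a ≤ b) =
      s.count a + Multiset.card (s.filter fun b => a + 1 ≤ b) := by
    intro s a
    induction s using Multiset.induction_on with
    | empty => simp
    | cons b s ih =>
      simp only [Multiset.filter_cons, Multiset.card_add, Multiset.count_cons, ih]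
      split_ifs <;> simp <;> omega
  apply Nat.Partition.ext
  ext a
  rcases Nat.eq_zero_or_pos a with rfl | ha
  · rw [Multiset.count_eq_zero_of_notMem, Multiset.count_eq_zero_of_notMem]
    · intro h0; exact absurd (r.parts_pos h0) (by omega)
    · intro h0; exact absurd (p.parts_pos h0) (by omega)
  · have h1 := hcount p.parts a
    have h2 := hcount r.parts a
    have h3 := hcard a ha
    have h4 := hcard (a + 1) (by omega)
    omega

/-- Conjugation reverses dominance. -/
theorem conj_dom {n : ℕ} (p l : Nat.Partition n) (h : ∀ k, conjSum p k ≤ conjSum l k) (k : ℕ) :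
    partSum l k ≤ partSum p k := by
  unfold partSum
  set b : ℕ → ℕ := fun j => Multiset.card (p.parts.filter fun a => j ≤ a) with hb
  set d : ℕ → ℕ := fun j => Multiset.card (l.parts.filter fun a => j ≤ a) with hd
  have hB : ∀ m, ∑ i ∈ Finset.Icc 1 m, b i ≤ ∑ i ∈ Finset.Icc 1 m, d i := by
    intro m
    have := h m
    unfold conjSum at this
    rwa [min_sum, min_sum] at this
  have hbn : ∑ i ∈ Finset.Icc 1 n, b i = n := by
    have h1 := conjSum_large p n le_rfl
    rw [conjSum, min_sum] at h1
    exact h1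
  have hdn : ∑ i ∈ Finset.Icc 1 n, d i = n := by
    have h1 := conjSum_large l n le_rfl
    rw [conjSum, min_sum] at h1
    exact h1
  have hanti : ∀ i j, i ≤ j → b j ≤ b i := by
    intro i j hij
    apply Multiset.card_le_card
    apply Multiset.monotone_filter_right
    intro a ha
    omega
  -- the threshold
  have hex : ∃ m, m ≤ n ∧ (∀ j ∈ Finset.Icc 1 m, k ≤ b j) ∧ ∀ j, m < j → j ≤ n → b j ≤ k := by
    by_cases hall : ∃ j, 1 ≤ j ∧ j ≤ n ∧ b j ≤ k
    · have hf := Nat.find_spec hall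
      have hm : ∀ j, j < Nat.find hall → ¬ (1 ≤ j ∧ j ≤ n ∧ b j ≤ k) :=
        fun j hj => Nat.find_min hall hj
      refine ⟨Nat.find hall - 1, by omega, ?_, ?_⟩
      · intro j hj
        rw [Finset.mem_Icc] at hj
        have := hm j (by omega)
        by_contra hc
        exact this ⟨hj.1, by omega, by omega⟩
      · intro j hj _
        exact (hanti (Nat.find hall) j (by omega)).trans hf.2.2
    · push Not at hall
      refine ⟨n, le_rfl, ?_, ?_⟩
      · intro j hj
        rw [Finset.mem_Icc] at hj
        exact (hall j hj.1 hj.2).le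
      · intro j h1 h2; omega
  obtain ⟨m, hmn, hm1, hm2⟩ := hex
  have hsplit : ∀ f : ℕ → ℕ, ∑ i ∈ Finset.Icc 1 n, f i =
      ∑ i ∈ Finset.Icc 1 m, f i + ∑ i ∈ Finset.Ioc m n, f i := by
    intro f
    rw [← Finset.sum_union]
    · congr 1
      ext i; simp only [Finset.mem_union, Finset.mem_Icc, Finset.mem_Ioc]; omega
    · rw [Finset.disjoint_left]
      intro i; simp only [Finset.mem_Icc, Finset.mem_Ioc]; omega
  have e1 : ∑ i ∈ Finset.Icc 1 m, min (b i) k = ∑ i ∈ Finset.Icc 1 m, k :=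
    Finset.sum_congr rfl fun i hi => by have := hm1 i hi; omega
  have e2 : ∑ i ∈ Finset.Ioc m n, min (b i) k = ∑ i ∈ Finset.Ioc m n, b i :=
    Finset.sum_congr rfl fun i hi => by
      rw [Finset.mem_Ioc] at hi
      have := hm2 i hi.1 hi.2; omega
  have f1 : ∑ i ∈ Finset.Icc 1 m, min (d i) k ≤ ∑ i ∈ Finset.Icc 1 m, k :=
    Finset.sum_le_sum fun i _ => min_le_right _ _
  have f2 : ∑ i ∈ Finset.Ioc m n, min (d i) k ≤ ∑ i ∈ Finset.Ioc m n, d i :=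
    Finset.sum_le_sum fun i _ => min_le_left _ _
  have g1 := hsplit b
  have g2 := hsplit d
  have g3 := hB m
  have goal : ∑ i ∈ Finset.Icc 1 n, min (d i) k ≤ ∑ i ∈ Finset.Icc 1 n, min (b i) k := by
    rw [hsplit, hsplit fun i => min (b i) k, e1, e2]
    omega
  exact goal

theorem exists_conj (n : ℕ) (t : ℕ → ℕ) (hanti : ∀ i, 1 ≤ i → t (i + 1) ≤ t i)
    (hz : t (n + 1) = 0) (hz' : ∀ i, n < i → t i = 0)
    (hsum : ∑ i ∈ Finset.Icc 1 n, t i = n) :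
    ∃ l : Nat.Partition n, ∀ i, 1 ≤ i →
      Multiset.card (l.parts.filter fun a => i ≤ a) = t i := by
  let s : Multiset ℕ := ∑ a ∈ Finset.Icc 1 n, Multiset.replicate (t a - t (a + 1)) a
  have hmem : ∀ a ∈ s, 1 ≤ a ∧ a ≤ n := by
    intro a ha
    rw [Multiset.mem_sum] at ha
    obtain ⟨b, hb, hab⟩ := ha
    rw [Multiset.eq_of_mem_replicate hab]
    exact Finset.mem_Icc.1 hb
  have htel : ∀ m, 1 ≤ m → m ≤ n + 1 →
      ∑ a ∈ Finset.Icc 1 n, (if m ≤ a then t a - t (a + 1) else 0) = t m := by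
    intro m hm hmn
    rw [← Finset.sum_filter]
    have : (Finset.Icc 1 n).filter (fun a => m ≤ a) = Finset.Ico m (n + 1) := by
      ext i; simp only [Finset.mem_filter, Finset.mem_Icc, Finset.mem_Ico]; omega
    rw [this]
    clear this
    induction hmn using Nat.decreasingInduction with
    | self => simp [hz]
    | of_succ k hk ih =>
      rw [Finset.sum_eq_sum_Ico_succ_bot hk, ih (by omega)]
      have := hanti k hm
      omega
  have hcard : ∀ i, 1 ≤ i → Multiset.card (s.filter fun a => i ≤ a) = t i := by
    intro i hi
    by_cases hin : i ≤ n + 1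
    · rw [← htel i hi hin]
      have hc : ∀ (F : Finset ℕ) (f : ℕ → Multiset ℕ),
          Multiset.card ((∑ a ∈ F, f a).filter fun a => i ≤ a) =
            ∑ a ∈ F, Multiset.card ((f a).filter fun a => i ≤ a) := by
        intro F f
        induction F using Finset.induction_on with
        | empty => simp
        | insert x F hx ih => rw [Finset.sum_insert hx, Finset.sum_insert hx, Multiset.filter_add,
            Multiset.card_add, ih]
      rw [hc]
      refine Finset.sum_congr rfl fun a _ => ?_
      split_ifs with h
      · rw [Multiset.filter_eq_self.2, Multiset.card_replicate]
        intro b hb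
        rw [Multiset.eq_of_mem_replicate hb]; exact h
      · rw [Multiset.filter_eq_nil.2, Multiset.card_zero]
        intro b hb
        rw [Multiset.eq_of_mem_replicate hb]; exact h
    · rw [hz' i (by omega), Multiset.filter_eq_nil.2, Multiset.card_zero]
      intro b hb
      have := hmem b hb
      omega
  refine ⟨⟨s, fun {a} ha => (hmem a ha).1, ?_⟩, hcard⟩
  have h1 := min_sum s n
  rw [Finset.sum_congr rfl fun i hi => hcard i (Finset.mem_Icc.1 hi).1, hsum,
    Multiset.map_congr (g := id) rfl] at h1
  · simpa using h1
  · intro a ha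
    have := hmem a ha
    simp; omega

/-! ### Elementary symmetric polynomials -/

/-- The exponent of the squarefree monomial of `t`. -/
noncomputable def ind {N : ℕ} (t : Finset (Fin N)) : Fin N →₀ ℕ := ∑ i ∈ t, Finsupp.single i 1

theorem ind_apply {N : ℕ} (t : Finset (Fin N)) (x : Fin N) :
    ind t x = if x ∈ t then 1 else 0 := by
  unfold ind
  rw [Finsupp.finsetSum_apply]
  simp [Finsupp.single_apply]

theorem ind_sum {N : ℕ} (t T : Finset (Fin N)) : ∑ x ∈ T, ind t x = (T ∩ t).card := by
  simp only [ind_apply]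
  rw [← Finset.card_filter, Finset.filter_mem_eq_inter]

theorem ind_inj {N : ℕ} (t u : Finset (Fin N)) (h : ind t = ind u) : t = u := by
  ext x
  have := DFunLike.congr_fun h x
  rw [ind_apply, ind_apply] at this
  split_ifs at this <;> simp_all

theorem coeff_esymm_ne {N : ℕ} {R : Type} [CommRing R] (a : ℕ) (d : Fin N →₀ ℕ)
    (h : coeff d (esymm (Fin N) R a) ≠ 0) : ∃ t : Finset (Fin N), t.card = a ∧ d = ind t := by
  rw [esymm_eq_sum_monomial, coeff_sum] at h
  obtain ⟨t, ht, hne⟩ := Finset.exists_ne_zero_of_sum_ne_zero h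
  rw [coeff_monomial] at hne
  refine ⟨t, (Finset.mem_powersetCard.1 ht).2, ?_⟩
  by_contra hc
  exact hne (if_neg fun h => hc h.symm)

theorem coeff_esymm_ind {N : ℕ} {R : Type} [CommRing R] (t : Finset (Fin N)) :
    coeff (ind t) (esymm (Fin N) R t.card) = 1 := by
  rw [esymm_eq_sum_monomial, coeff_sum, Finset.sum_eq_single t]
  · rw [coeff_monomial]; exact if_pos rfl
  · intro u _ hu
    rw [coeff_monomial]
    exact if_neg fun h => hu (ind_inj _ _ h)
  · intro h
    exact absurd (Finset.mem_powersetCard.2 ⟨Finset.subset_univ _, rfl⟩) h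

theorem coeff_prod_bound {N : ℕ} {R : Type} [CommRing R] (s : Multiset ℕ) :
    ∀ d : Fin N →₀ ℕ, coeff d (s.map fun k => esymm (Fin N) R k).prod ≠ 0 →
      ∀ T : Finset (Fin N), ∑ x ∈ T, d x ≤ (s.map fun a => min a T.card).sum := by
  induction s using Multiset.induction_on with
  | empty =>
    intro d hd T
    simp only [Multiset.map_zero, Multiset.prod_zero, coeff_one] at hd
    have : d = 0 := by
      by_contra hc
      exact hd (if_neg fun h => hc h.symm)
    simp [this]
  | cons a s ih =>
    intro d hd T
    rw [Multiset.map_cons, Multiset.prod_cons, coeff_mul] at hd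
    obtain ⟨⟨d1, d2⟩, hmem, hne⟩ := Finset.exists_ne_zero_of_sum_ne_zero hd
    rw [Finset.HasAntidiagonal.mem_antidiagonal] at hmem
    obtain ⟨t, ht, rfl⟩ := coeff_esymm_ne a d1 (left_ne_zero_of_mul hne)
    have h2 := ih d2 (right_ne_zero_of_mul hne) T
    rw [Multiset.map_cons, Multiset.sum_cons, ← hmem]
    simp only [Finsupp.add_apply, Finset.sum_add_distrib]
    rw [ind_sum]
    have h3 := Finset.card_le_card (Finset.inter_subset_left (s₁ := T) (s₂ := t))
    have h4 := Finset.card_le_card (Finset.inter_subset_right (s₁ := T) (s₂ := t))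
    have : (T ∩ t).card ≤ min a T.card := by omega
    simp only at *
    omega

/-- The first `a` variables. -/
def ini (N a : ℕ) : Finset (Fin N) := Finset.univ.filter fun x : Fin N => x.val < a

theorem ini_card (N a : ℕ) (h : a ≤ N) : (ini N a).card = a := by
  unfold ini
  rw [Fin.card_filter_val_lt]
  omega

theorem ini_inter (N a b : ℕ) : ini N a ∩ ini N b = ini N (min b a) := by
  ext x; simp only [ini, Finset.mem_inter, Finset.mem_filter, Finset.mem_univ, true_and]; omega

/-- The exponent of the conjugate of `s`. -/
noncomputable def dOf (N : ℕ) (s : Multiset ℕ) : Fin N →₀ ℕ := (s.map fun a => ind (ini N a)).sum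

theorem dOf_cons (N a : ℕ) (s : Multiset ℕ) : dOf N (a ::ₘ s) = ind (ini N a) + dOf N s := by
  simp [dOf]

theorem dOf_apply (N : ℕ) (s : Multiset ℕ) (x : Fin N) :
    dOf N s x = Multiset.card (s.filter fun a => x.val + 1 ≤ a) := by
  induction s using Multiset.induction_on with
  | empty => simp [dOf]
  | cons a s ih =>
    rw [dOf_cons, Finsupp.add_apply, ih, ind_apply, Multiset.filter_cons, Multiset.card_add]
    congr 1
    simp only [ini, Finset.mem_filter, Finset.mem_univ, true_and, Nat.succ_le_iff]
    split_ifs <;> simp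

theorem dOf_sum (N : ℕ) (s : Multiset ℕ) (k : ℕ) (hk : k ≤ N) :
    ∑ x ∈ ini N k, dOf N s x = (s.map fun a => min a k).sum := by
  induction s using Multiset.induction_on with
  | empty => simp [dOf]
  | cons a s ih =>
    rw [dOf_cons, Multiset.map_cons, Multiset.sum_cons]
    simp only [Finsupp.add_apply, Finset.sum_add_distrib]
    rw [ih, ind_sum, ini_inter, ini_card _ _ (by omega)]

theorem coeff_dOf {N : ℕ} {R : Type} [CommRing R] (s : Multiset ℕ) :
    (∀ a ∈ s, a ≤ N) → coeff (dOf N s) (s.map fun k => esymm (Fin N) R k).prod = 1 := by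
  induction s using Multiset.induction_on with
  | empty =>
    intro _
    simp [dOf]
  | cons a s ih =>
    intro hs
    have ha : a ≤ N := hs a (Multiset.mem_cons_self _ _)
    have ih' := ih fun b hb => hs b (Multiset.mem_cons_of_mem hb)
    rw [Multiset.map_cons, Multiset.prod_cons, coeff_mul,
      Finset.sum_eq_single (ind (ini N a), dOf N s)]
    · simp only
      rw [ih', mul_one]
      have := coeff_esymm_ind (R := R) (ini N a)
      rwa [ini_card N a ha] at this
    · rintro ⟨d1, d2⟩ hmem hne
      rw [Finset.HasAntidiagonal.mem_antidiagonal] at hmem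
      simp only at hmem ⊢
      by_contra hnz
      obtain ⟨t, ht, rfl⟩ := coeff_esymm_ne a d1 (left_ne_zero_of_mul hnz)
      have h2 := coeff_prod_bound s d2 (right_ne_zero_of_mul hnz) (ini N a)
      rw [ini_card N a ha, ← dOf_sum N s a ha] at h2
      have h3 : ∑ x ∈ ini N a, (ind t + d2) x = ∑ x ∈ ini N a, (ind (ini N a) + dOf N s) x := by
        rw [hmem, dOf_cons]
      simp only [Finsupp.add_apply, Finset.sum_add_distrib] at h3
      rw [ind_sum, ind_sum, Finset.inter_self, ini_card N a ha] at h3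
      have h4 : a ≤ (ini N a ∩ t).card := by omega
      have h5 : ini N a ∩ t = t :=
        Finset.eq_of_subset_of_card_le Finset.inter_subset_right (by omega)
      have h6 : ini N a ∩ t = ini N a :=
        Finset.eq_of_subset_of_card_le Finset.inter_subset_left (by rw [ini_card N a ha]; omega)
      have h7 : t = ini N a := h5.symm.trans h6
      subst h7
      rw [dOf_cons] at hmem
      exact hne (by rw [add_left_cancel hmem])
    · intro h
      exact absurd (Finset.HasAntidiagonal.mem_antidiagonal.2 (dOf_cons N a s).symm) h

/-! ### The main argument -/

theorem main {n N : ℕ} (hN : n ≤ N) (G : SimpleGraph (Fin n)) (hG : IsNUIG G)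
    {R : Type} [CommRing R] (φ : R →+* ℤ) (w : (Fin n → Fin N) → R) (hw : ∀ κ, φ (w κ) = 1)
    (c : Nat.Partition n → R)
    (hc : (∑ κ : Fin n → Fin N, if IsProper G κ then C (w κ) * ∏ i, X (κ i) else 0) =
      ∑ p : Nat.Partition n, C (c p) * eProd N R p)
    (l : Nat.Partition n)
    (hl : ∀ i, 1 ≤ i → Multiset.card (l.parts.filter fun a => i ≤ a) = typeCount G i) :
    c l ≠ 0 ∧ ∀ p, c p ≠ 0 → ∀ k, conjSum p k ≤ conjSum l k := by
  have hlsum : ∀ k, conjSum l k = ∑ i ∈ Finset.Icc 1 k, typeCount G i := by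
    intro k
    unfold conjSum
    rw [min_sum]
    exact Finset.sum_congr rfl fun i hi => hl i (Finset.mem_Icc.1 hi).1
  have hcoef : ∀ d : Fin N →₀ ℕ,
      coeff d (∑ p : Nat.Partition n, C (c p) * eProd N R p) =
        ∑ κ : Fin n → Fin N, if IsProper G κ ∧ ∑ i, Finsupp.single (κ i) 1 = d
          then w κ else 0 := by
    intro d
    rw [← hc, coeff_sum]
    refine Finset.sum_congr rfl fun κ _ => ?_
    by_cases hp : IsProper G κ
    · have : (∏ i, X (κ i) : MvPolynomial (Fin N) R) =
          monomial (∑ i, Finsupp.single (κ i) 1) 1 := by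
        rw [monomial_sum_one]; rfl
      simp only [hp, if_true, true_and]
      rw [this, coeff_C_mul, coeff_monomial]
      split_ifs <;> simp
    · simp [hp]
  have hsumκ : ∀ (κ : Fin n → Fin N) (T : Finset (Fin N)),
      ∑ x ∈ T, (∑ i, Finsupp.single (κ i) 1 : Fin N →₀ ℕ) x =
        (Finset.univ.filter fun v => κ v ∈ T).card := by
    intro κ T
    simp only [Finsupp.finsetSum_apply, Finsupp.single_apply]
    rw [Finset.sum_comm, Finset.card_filter]
    simp
  have fact1 : ∀ d : Fin N →₀ ℕ,
      coeff d (∑ p : Nat.Partition n, C (c p) * eProd N R p) ≠ 0 →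
      ∀ T : Finset (Fin N), ∑ x ∈ T, d x ≤ conjSum l T.card := by
    intro d hd T
    rw [hcoef] at hd
    obtain ⟨κ, _, hne⟩ := Finset.exists_ne_zero_of_sum_ne_zero hd
    have hκ : IsProper G κ ∧ ∑ i, Finsupp.single (κ i) 1 = d := by
      by_contra hcon
      exact hne (if_neg hcon)
    rw [← hκ.2, hsumκ, hlsum]
    exact proper_bound G hG κ hκ.1 T
  have fact2 : coeff (dOf N l.parts) (∑ p : Nat.Partition n, C (c p) * eProd N R p) ≠ 0 := by
    intro h0
    rw [hcoef] at h0
    have h1 := congrArg φ h0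
    rw [map_sum, map_zero] at h1
    have h2 : ∀ κ : Fin n → Fin N, φ (if IsProper G κ ∧
        ∑ i, Finsupp.single (κ i) 1 = dOf N l.parts then w κ else 0) =
        if IsProper G κ ∧ ∑ i, Finsupp.single (κ i) 1 = dOf N l.parts then 1 else 0 := by
      intro κ
      split_ifs
      · exact hw κ
      · exact map_zero φ
    rw [Finset.sum_congr rfl fun κ _ => h2 κ] at h1
    rw [Finset.sum_eq_zero_iff_of_nonneg (fun κ _ => by split_ifs <;> simp)] at h1
    let κ : Fin n → Fin N := fun v => ⟨greedy G v - 1, by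
      have h3 := (greedy_spec G v).1
      have h4 := greedy_le G v
      omega⟩
    have h3 := h1 κ (Finset.mem_univ _)
    rw [if_pos] at h3
    · exact one_ne_zero h3
    · refine ⟨?_, ?_⟩
      · intro i j hij hκ
        have h4 := (greedy_spec G i).1
        have h5 := (greedy_spec G j).1
        have h6 : greedy G i - 1 = greedy G j - 1 := congrArg Fin.val hκ
        exact greedy_ne G i j hij (by omega)
      · ext x
        have h4 := hsumκ κ {x}
        rw [Finset.sum_singleton] at h4
        rw [h4, dOf_apply, hl _ (by omega)]
        unfold typeCount
        congr 1
        ext v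
        simp only [Finset.mem_filter, Finset.mem_univ, true_and, Finset.mem_singleton,
          Fin.ext_iff, κ]
        have := (greedy_spec G v).1
        omega
  have fact3 : ∀ (d : Fin N →₀ ℕ) (r : Nat.Partition n), coeff d (C (c r) * eProd N R r) ≠ 0 →
      c r ≠ 0 ∧ ∀ T : Finset (Fin N), ∑ x ∈ T, d x ≤ conjSum r T.card := by
    intro d r hd
    rw [coeff_C_mul] at hd
    exact ⟨left_ne_zero_of_mul hd, coeff_prod_bound r.parts d (right_ne_zero_of_mul hd)⟩
  have fact4 : ∀ r p : Nat.Partition n, coeff (dOf N p.parts) (C (c r) * eProd N R r) ≠ 0 →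
      c r ≠ 0 ∧ ∀ k, conjSum p k ≤ conjSum r k := by
    intro r p h
    obtain ⟨h1, h2⟩ := fact3 _ _ h
    refine ⟨h1, fun k => ?_⟩
    rcases le_total k n with hk | hk
    · have := h2 (ini N k)
      rwa [dOf_sum _ _ _ (by omega), ini_card _ _ (by omega)] at this
    · rw [conjSum_large _ _ hk, conjSum_large _ _ hk]
  have dom : ∀ p, c p ≠ 0 → ∀ k, conjSum p k ≤ conjSum l k := by
    by_contra! hcon
    obtain ⟨p0, hp0, k0, hk0⟩ := hcon
    let S : Finset (Nat.Partition n) :=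
      Finset.univ.filter fun p => c p ≠ 0 ∧ ¬ ∀ k, conjSum p k ≤ conjSum l k
    have hS : S.Nonempty := ⟨p0, by
      simp only [S, Finset.mem_filter, Finset.mem_univ, true_and]
      exact ⟨hp0, fun h => absurd (h k0) (by omega)⟩⟩
    obtain ⟨p, hpS, hmax⟩ :=
      Finset.exists_max_image S (fun p => ∑ k ∈ Finset.range (n + 1), conjSum p k) hS
    have hp := (Finset.mem_filter.1 hpS).2
    apply hp.2
    have hco : coeff (dOf N p.parts) (∑ r : Nat.Partition n, C (c r) * eProd N R r) = c p := by
      rw [coeff_sum, Finset.sum_eq_single p]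
      · rw [coeff_C_mul, eProd, coeff_dOf, mul_one]
        intro a ha
        exact (part_le p a ha).trans hN
      · intro r _ hr
        by_contra hne
        obtain ⟨h1, h2⟩ := fact4 r p hne
        have hrS : r ∈ S := by
          simp only [S, Finset.mem_filter, Finset.mem_univ, true_and]
          exact ⟨h1, fun h => hp.2 fun k => (h2 k).trans (h k)⟩
        have h3 := hmax r hrS
        have h4 : ∀ k ∈ Finset.range (n + 1), conjSum p k = conjSum r k :=
          (Finset.sum_eq_sum_iff_of_le fun k _ => h2 k).1
            (le_antisymm (Finset.sum_le_sum fun k _ => h2 k) h3)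
        exact hr (conjSum_inj p r fun k hk => h4 k (Finset.mem_range.2 (by omega))).symm
      · intro h; exact absurd (Finset.mem_univ _) h
    intro k
    rcases le_total k n with hk | hk
    · have := fact1 (dOf N p.parts) (by rw [hco]; exact hp.1) (ini N k)
      rwa [dOf_sum _ _ _ (by omega), ini_card _ _ (by omega)] at this
    · rw [conjSum_large _ _ hk, conjSum_large _ _ hk]
  refine ⟨?_, dom⟩
  intro hcl
  rw [coeff_sum] at fact2
  obtain ⟨r, _, hr⟩ := Finset.exists_ne_zero_of_sum_ne_zero fact2
  obtain ⟨h1, h2⟩ := fact4 r l hr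
  have : r = l := conjSum_inj r l fun k _ => le_antisymm (dom r h1 k) (h2 k)
  rw [this] at h1
  exact h1 hcl

end Stmt10

/-- (1) the type `μ_G` of the greedy colouring is a partition;
(2) for `λ_G = μ_G'` the coefficients `c_{λ_G}` and `c_{λ_G}(q)` are nonzero;
(3) `c_λ ≠ 0` (or `c_λ(q) ≠ 0`) implies `λ ⊵ λ_G` in dominance order. -/
theorem stmt10 (n N : ℕ) (hN : n ≤ N) (G : SimpleGraph (Fin n)) (hG : IsNUIG G)
    (c : Nat.Partition n → ℤ)
    (hc : chromSym n N G = ∑ p : Nat.Partition n, C (c p) * eProd N ℤ p)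
    (cq : Nat.Partition n → Polynomial ℤ)
    (hcq : chromQSym n N G = ∑ p : Nat.Partition n, C (cq p) * eProd N (Polynomial ℤ) p) :
    (∀ i, 1 ≤ i → typeCount G (i + 1) ≤ typeCount G i) ∧
    (∃ l : Nat.Partition n, ∀ i, 1 ≤ i →
      Multiset.card (l.parts.filter fun a => i ≤ a) = typeCount G i) ∧
    (∀ l : Nat.Partition n,
      (∀ i, 1 ≤ i → Multiset.card (l.parts.filter fun a => i ≤ a) = typeCount G i) →
      c l ≠ 0 ∧ cq l ≠ 0 ∧
      (∀ p, c p ≠ 0 → ∀ k, partSum l k ≤ partSum p k) ∧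
      (∀ p, cq p ≠ 0 → ∀ k, partSum l k ≤ partSum p k)) := by
  have hanti := Stmt10.typeCount_anti G hG
  refine ⟨hanti, ?_, ?_⟩
  · have hz : ∀ i, n < i → typeCount G i = 0 := by
      intro i hi
      unfold typeCount
      rw [Finset.card_eq_zero, Finset.filter_eq_empty_iff]
      intro v _
      have := Stmt10.greedy_le G v
      omega
    refine Stmt10.exists_conj n (typeCount G) hanti (hz _ (by omega)) hz ?_
    rw [← Stmt10.card_greedy_le, Finset.filter_true_of_mem fun v _ => Stmt10.greedy_le G v]
    simp
  · intro l hl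
    have h1 := Stmt10.main hN G hG (RingHom.id ℤ) (fun _ => 1) (fun _ => rfl) c
      (by rw [← hc]; unfold chromSym; simp) l hl
    have h2 := Stmt10.main hN G hG (Polynomial.evalRingHom (1 : ℤ))
      (fun κ => Polynomial.X ^ ascNum G κ) (fun _ => by simp) cq
      (by rw [← hcq]; unfold chromQSym; rfl) l hl
    exact ⟨h1.1, h2.1, fun p hp => Stmt10.conj_dom p l (h1.2 p hp),
      fun p hp => Stmt10.conj_dom p l (h2.2 p hp)⟩
end

section
/- Let G be a natural unit interval graph on {1,…,n} and let T be a G-tableau of hook shape. (a) An entry j in the leg of T is movable if and only if ij ∉ E for every entry i of T occurring in a row above j. (b) If the entry j in the leg is movable, then the position in the arm to which it can be moved is unique, and every entry i above j in the leg of T satisfies i < j. -/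
open Finset
open scoped Classical

noncomputable section

/-- A hook-shaped `G`-tableau, encoded by the bijective map sending each entry
`v : Fin n` to its cell `(row, column)` (0-indexed, English notation).
The conditions say: the filling is injective, every cell lies in the first row
or the first column, the occupied cells of the first row and first column form
initial segments (so the shape is a hook diagram `(k, 1^(n-k))`), rows satisfy
(C1): left neighbour `i` of `j` has `i < j` and `ij ∉ E`, and columns satisfy
(C2): upper neighbour `i` of `j` has `i < j` or `ij ∈ E`. -/
def IsHookTab {n : ℕ} (G : SimpleGraph (Fin n))
    (f : Fin n → Fin (n + 1) × Fin (n + 1)) : Prop :=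
  Function.Injective f ∧
  (∀ v, ((f v).1 : ℕ) = 0 ∨ ((f v).2 : ℕ) = 0) ∧
  (∀ v, ((f v).1 : ℕ) = 0 → 0 < ((f v).2 : ℕ) →
    ∃ u, ((f u).1 : ℕ) = 0 ∧ ((f u).2 : ℕ) + 1 = ((f v).2 : ℕ)) ∧
  (∀ v, ((f v).2 : ℕ) = 0 → 0 < ((f v).1 : ℕ) →
    ∃ u, ((f u).2 : ℕ) = 0 ∧ ((f u).1 : ℕ) + 1 = ((f v).1 : ℕ)) ∧
  (∀ u v, ((f u).1 : ℕ) = 0 → ((f v).1 : ℕ) = 0 →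
    ((f v).2 : ℕ) = ((f u).2 : ℕ) + 1 → u < v ∧ ¬ G.Adj u v) ∧
  (∀ u v, ((f u).2 : ℕ) = 0 → ((f v).2 : ℕ) = 0 →
    ((f v).1 : ℕ) = ((f u).1 : ℕ) + 1 → u < v ∨ G.Adj u v)

/-- The entry `v` lies in the arm (first row, excluding the corner cell). -/
def InArm {n : ℕ} (f : Fin n → Fin (n + 1) × Fin (n + 1)) (v : Fin n) : Prop :=
  ((f v).1 : ℕ) = 0 ∧ ((f v).2 : ℕ) ≠ 0

/-- The entry `v` lies in the leg (first column, excluding the corner cell). -/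
def InLeg {n : ℕ} (f : Fin n → Fin (n + 1) × Fin (n + 1)) (v : Fin n) : Prop :=
  ((f v).2 : ℕ) = 0 ∧ ((f v).1 : ℕ) ≠ 0

/-- The set of inversions of a tableau: pairs `(i,j)` with `i < j`, `ij ∈ E`,
and `i` in a lower row than `j`. -/
def InvSet {n : ℕ} (G : SimpleGraph (Fin n))
    (f : Fin n → Fin (n + 1) × Fin (n + 1)) : Finset (Fin n × Fin n) :=
  Finset.univ.filter fun p =>
    p.1 < p.2 ∧ G.Adj p.1 p.2 ∧ ((f p.2).1 : ℕ) < ((f p.1).1 : ℕ)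

/-- `g` is obtained from `f` by moving the entry `j` (between the arm and leg),
keeping all other entries in their regions and relative order, so that `g` is
again a `G`-tableau with the same inversion set. -/
def MoveCore {n : ℕ} (G : SimpleGraph (Fin n))
    (f g : Fin n → Fin (n + 1) × Fin (n + 1)) (j : Fin n) : Prop :=
  IsHookTab G g ∧
  (∀ u, u ≠ j → ((InArm f u ↔ InArm g u) ∧ (InLeg f u ↔ InLeg g u))) ∧
  (∀ u u', u ≠ j → u' ≠ j → InArm f u → InArm f u' →
    (((f u).2 : ℕ) < ((f u').2 : ℕ) ↔ ((g u).2 : ℕ) < ((g u').2 : ℕ))) ∧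
  (∀ u u', u ≠ j → u' ≠ j → InLeg f u → InLeg f u' →
    (((f u).1 : ℕ) < ((f u').1 : ℕ) ↔ ((g u).1 : ℕ) < ((g u').1 : ℕ))) ∧
  InvSet G g = InvSet G f

/-- `g` is the result of moving the arm entry `j` of `f` to the leg. -/
def ArmToLeg {n : ℕ} (G : SimpleGraph (Fin n))
    (f g : Fin n → Fin (n + 1) × Fin (n + 1)) (j : Fin n) : Prop :=
  InArm f j ∧ InLeg g j ∧ MoveCore G f g j

/-- `g` is the result of moving the leg entry `j` of `f` to the arm. -/
def LegToArm {n : ℕ} (G : SimpleGraph (Fin n))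
    (f g : Fin n → Fin (n + 1) × Fin (n + 1)) (j : Fin n) : Prop :=
  InLeg f j ∧ InArm g j ∧ MoveCore G f g j

/-- The entry `j` is movable. -/
def MovableEntry {n : ℕ} (G : SimpleGraph (Fin n))
    (f : Fin n → Fin (n + 1) × Fin (n + 1)) (j : Fin n) : Prop :=
  (∃ g, ArmToLeg G f g j) ∨ (∃ g, LegToArm G f g j)

/-- `HT n G`: the type of hook-shaped `G`-tableaux. -/
abbrev HT (n : ℕ) (G : SimpleGraph (Fin n)) :=
  {f : Fin n → Fin (n + 1) × Fin (n + 1) // IsHookTab G f}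

lemma MovableEntry.exists_tab {n : ℕ} {G : SimpleGraph (Fin n)}
    {f : Fin n → Fin (n + 1) × Fin (n + 1)} {j : Fin n} (h : MovableEntry G f j) :
    ∃ g, IsHookTab G g ∧ (ArmToLeg G f g j ∨ LegToArm G f g j) := by
  rcases h with ⟨g, hg⟩ | ⟨g, hg⟩
  · exact ⟨g, hg.2.2.1, Or.inl hg⟩
  · exact ⟨g, hg.2.2.1, Or.inr hg⟩

/-- The involution `φ_G`: if `T` has a movable entry, move the smallest movable
entry `j` (producing `T^j`); otherwise fix `T`. -/
noncomputable def phi {n : ℕ} {G : SimpleGraph (Fin n)} (T : HT n G) : HT n G :=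
  if h : (Finset.univ.filter fun j : Fin n => MovableEntry G T.1 j).Nonempty then
    have hj : MovableEntry G T.1
        ((Finset.univ.filter fun j : Fin n => MovableEntry G T.1 j).min' h) :=
      (Finset.mem_filter.mp (Finset.min'_mem _ h)).2
    ⟨Classical.choose hj.exists_tab, (Classical.choose_spec hj.exists_tab).1⟩
  else T

/-- The number of arm entries of `T`; the shape of `T` is `(k, 1^(n-k))` with
`k = armCard T + 1`. -/
def armCard {n : ℕ} {G : SimpleGraph (Fin n)} (T : HT n G) : ℕ :=
  (Finset.univ.filter fun v => InArm T.1 v).card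

/-- The sign `(-1)^(k-1)` of a hook tableau of shape `(k, 1^(n-k))`. -/
def tabSign {n : ℕ} {G : SimpleGraph (Fin n)} (T : HT n G) : ℤ :=
  (-1) ^ armCard T

/-- The number of inversions of `T`. -/
def tabInv {n : ℕ} (G : SimpleGraph (Fin n)) (T : HT n G) : ℕ :=
  (InvSet G T.1).card

/-- `b_k`: the number of neighbours of `k` smaller than `k`. -/
def smallerNbrs {n : ℕ} (G : SimpleGraph (Fin n)) (k : Fin n) : ℕ :=
  (Finset.univ.filter fun i : Fin n => i < k ∧ G.Adj i k).card

/-- `r` is an orientation of `G`: every arc is an edge and every edge gets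
exactly one direction. -/
def IsOrientation {V : Type*} (G : SimpleGraph V) (r : V → V → Prop) : Prop :=
  (∀ u v, r u v → G.Adj u v) ∧ (∀ u v, G.Adj u v → (r u v ↔ ¬ r v u))

/-- `r` is an acyclic orientation of `G`. -/
def IsAcyclicOrientation {V : Type*} (G : SimpleGraph V) (r : V → V → Prop) : Prop :=
  IsOrientation G r ∧ ∀ v, ¬ Relation.TransGen r v v

/-- `v` is a sink: it has no outgoing arc. -/
def IsSinkOf {V : Type*} (r : V → V → Prop) (v : V) : Prop := ∀ u, ¬ r v u

/-- `f` is a `G`-tableau of column shape `1^n`. -/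
def IsColTab {n : ℕ} (G : SimpleGraph (Fin n))
    (f : Fin n → Fin (n + 1) × Fin (n + 1)) : Prop :=
  IsHookTab G f ∧ ∀ v, ((f v).2 : ℕ) = 0

/-- The orientation `ψ(T)` associated to a column tableau: each edge is directed
from the entry occurring lower in `T` to the entry occurring higher. -/
def psi {n : ℕ} (G : SimpleGraph (Fin n))
    (f : Fin n → Fin (n + 1) × Fin (n + 1)) : Fin n → Fin n → Prop :=
  fun u v => G.Adj u v ∧ ((f v).1 : ℕ) < ((f u).1 : ℕ)

end

/-- Rank of `v` within `S` with respect to the key `k`. -/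
def rkOf {n : ℕ} (S : Finset (Fin n)) (k : Fin n → ℕ) (v : Fin n) : ℕ :=
  (S.filter (fun u => k u < k v)).card

lemma rkOf_le {n : ℕ} (S : Finset (Fin n)) (k : Fin n → ℕ) (v : Fin n) :
    rkOf S k v < n + 1 := by
  have := Finset.card_le_univ (S.filter (fun u => k u < k v))
  simp only [Fintype.card_fin] at this
  unfold rkOf
  omega

lemma rkOf_mono {n : ℕ} (S : Finset (Fin n)) (k : Fin n → ℕ) {u v : Fin n}
    (h : k u ≤ k v) : rkOf S k u ≤ rkOf S k v := by
  apply Finset.card_le_card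
  intro w hw
  simp only [Finset.mem_filter] at hw ⊢
  exact ⟨hw.1, by omega⟩

lemma rkOf_lt {n : ℕ} (S : Finset (Fin n)) (k : Fin n → ℕ) {u v : Fin n}
    (hu : u ∈ S) : rkOf S k u < rkOf S k v ↔ k u < k v := by
  constructor
  · intro h
    by_contra hc
    have := rkOf_mono S k (u := v) (v := u) (by omega)
    omega
  · intro h
    apply Finset.card_lt_card
    rw [Finset.ssubset_iff_of_subset]
    · exact ⟨u, by simp [hu, h], by simp⟩
    · intro w hw
      simp only [Finset.mem_filter] at hw ⊢
      exact ⟨hw.1, by omega⟩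

lemma rkOf_pred {n : ℕ} (S : Finset (Fin n)) (k : Fin n → ℕ)
    (hk : ∀ u ∈ S, ∀ v ∈ S, k u = k v → u = v) {v : Fin n}
    (h : 0 < rkOf S k v) : ∃ u ∈ S, rkOf S k u + 1 = rkOf S k v := by
  obtain ⟨u, hu, hmax⟩ := Finset.exists_max_image _ k (Finset.card_pos.mp h)
  simp only [Finset.mem_filter] at hu hmax
  refine ⟨u, hu.1, ?_⟩
  have : S.filter (fun w => k w < k v) = insert u (S.filter (fun w => k w < k u)) := by
    ext w
    simp only [Finset.mem_filter, Finset.mem_insert]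
    constructor
    · rintro ⟨h1, h2⟩
      have := hmax w ⟨h1, h2⟩
      by_cases e : k w = k u
      · exact Or.inl (hk w h1 u hu.1 e)
      · exact Or.inr ⟨h1, by omega⟩
    · rintro (rfl | ⟨h1, h2⟩)
      · exact hu
      · exact ⟨h1, by omega⟩
  unfold rkOf
  rw [this, Finset.card_insert_of_notMem (by simp)]

lemma eq_rkOf {n : ℕ} (S : Finset (Fin n)) (k h : Fin n → ℕ)
    (hinj : ∀ u ∈ S, ∀ v ∈ S, h u = h v → u = v)
    (hlt : ∀ u ∈ S, ∀ v ∈ S, (h u < h v ↔ k u < k v))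
    (hpred : ∀ v ∈ S, 0 < h v → ∃ u ∈ S, h u + 1 = h v) :
    ∀ v ∈ S, h v = rkOf S k v := by
  have key : ∀ m, ∀ v ∈ S, h v = m → rkOf S k v = m := by
    intro m
    induction m with
    | zero =>
      intro v hv h0
      unfold rkOf
      rw [Finset.card_eq_zero, Finset.filter_eq_empty_iff]
      intro w hw hc
      have := (hlt w hw v hv).2 hc
      omega
    | succ m ih =>
      intro v hv h0
      obtain ⟨u, hu, hu1⟩ := hpred v hv (by omega)
      have h2 := ih u hu (by omega)
      have : S.filter (fun w => k w < k v) = insert u (S.filter (fun w => k w < k u)) := by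
        ext w
        simp only [Finset.mem_filter, Finset.mem_insert]
        constructor
        · rintro ⟨h1, h2⟩
          have := (hlt w h1 v hv).2 h2
          by_cases e : h w = h u
          · exact Or.inl (hinj w h1 u hu e)
          · exact Or.inr ⟨h1, (hlt w h1 u hu).1 (by omega)⟩
        · rintro (rfl | ⟨h1, h2⟩)
          · exact ⟨hu, (hlt w hu v hv).1 (by omega)⟩
          · have := (hlt w h1 u hu).2 h2
            exact ⟨h1, (hlt w h1 v hv).1 (by omega)⟩
      unfold rkOf at h2 ⊢
      rw [this, Finset.card_insert_of_notMem (by simp), h2]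
  intro v hv
  exact (key _ v hv rfl).symm

lemma hook_eq {n : ℕ} {G : SimpleGraph (Fin n)} {f : Fin n → Fin (n + 1) × Fin (n + 1)}
    (hf : IsHookTab G f) {u v : Fin n} (h1 : ((f u).1 : ℕ) = (f v).1)
    (h2 : ((f u).2 : ℕ) = (f v).2) : u = v :=
  hf.1 (Prod.ext (Fin.ext h1) (Fin.ext h2))

/-- The first row is increasing with pairwise non-adjacent entries. -/
lemma row_chain {n : ℕ} {G : SimpleGraph (Fin n)} (hG : IsNUIG G)
    {f : Fin n → Fin (n + 1) × Fin (n + 1)} (hf : IsHookTab G f) :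
    ∀ m : ℕ, ∀ u v : Fin n, ((f u).1 : ℕ) = 0 → ((f v).1 : ℕ) = 0 →
      ((f v).2 : ℕ) = m → ((f u).2 : ℕ) < m → u < v ∧ ¬ G.Adj u v := by
  intro m
  induction m with
  | zero => intro u v _ _ _ h; omega
  | succ m ih =>
    intro u v hu hv hm hlt
    obtain ⟨p, hp, hp1⟩ := hf.2.2.1 v hv (by omega)
    have hpv := hf.2.2.2.2.1 p v hp hv (by omega)
    by_cases e : ((f u).2 : ℕ) = m
    · have : u = p := hook_eq hf (by omega) (by omega)
      rw [this]; exact hpv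
    · have hup := ih u p hu hp (by omega) (by omega)
      refine ⟨hup.1.trans hpv.1, fun ha => ?_⟩
      exact hup.2 (hG u p v hup.1 hpv.1 ha).1

lemma row_lt_iff {n : ℕ} {G : SimpleGraph (Fin n)} (hG : IsNUIG G)
    {f : Fin n → Fin (n + 1) × Fin (n + 1)} (hf : IsHookTab G f) {u v : Fin n}
    (hu : ((f u).1 : ℕ) = 0) (hv : ((f v).1 : ℕ) = 0) :
    ((f u).2 : ℕ) < (f v).2 ↔ u < v := by
  constructor
  · intro h; exact (row_chain hG hf _ u v hu hv rfl h).1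
  · intro h
    rcases lt_trichotomy ((f u).2 : ℕ) (f v).2 with h1 | h1 | h1
    · exact h1
    · have := hook_eq hf (hu.trans hv.symm) h1
      exact absurd h (by rw [this]; exact lt_irrefl _)
    · exact absurd ((row_chain hG hf _ v u hv hu rfl h1).1) (not_lt.mpr h.le)

lemma row_nonadj {n : ℕ} {G : SimpleGraph (Fin n)} (hG : IsNUIG G)
    {f : Fin n → Fin (n + 1) × Fin (n + 1)} (hf : IsHookTab G f) {u v : Fin n}
    (hu : ((f u).1 : ℕ) = 0) (hv : ((f v).1 : ℕ) = 0) : ¬ G.Adj u v := by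
  rcases lt_trichotomy ((f u).2 : ℕ) (f v).2 with h1 | h1 | h1
  · exact (row_chain hG hf _ u v hu hv rfl h1).2
  · have := hook_eq hf (hu.trans hv.symm) h1
    rw [this]; exact G.loopless.irrefl v
  · exact fun h => (row_chain hG hf _ v u hv hu rfl h1).2 h.symm

/-- Entries of the first column at every height up to that of a column entry. -/
lemma col_exists {n : ℕ} {G : SimpleGraph (Fin n)}
    {f : Fin n → Fin (n + 1) × Fin (n + 1)} (hf : IsHookTab G f) :
    ∀ m : ℕ, ∀ v : Fin n, ((f v).2 : ℕ) = 0 → ((f v).1 : ℕ) = m →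
      ∃ c, ((f c).1 : ℕ) = 0 ∧ ((f c).2 : ℕ) = 0 := by
  intro m
  induction m with
  | zero => intro v h1 h2; exact ⟨v, h2, h1⟩
  | succ m ih =>
    intro v h1 h2
    obtain ⟨u, hu, hu1⟩ := hf.2.2.2.1 v h1 (by omega)
    exact ih u hu (by omega)

/-- Column entries above a leg entry non-adjacent to everything above are smaller. -/
lemma above_lt {n : ℕ} {G : SimpleGraph (Fin n)} (hG : IsNUIG G)
    {f : Fin n → Fin (n + 1) × Fin (n + 1)} (hf : IsHookTab G f) {j : Fin n}
    (hj : InLeg f j) (hna : ∀ i, ((f i).1 : ℕ) < ((f j).1 : ℕ) → ¬ G.Adj i j) :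
    ∀ m : ℕ, ∀ v : Fin n, ((f v).2 : ℕ) = 0 → ((f v).1 : ℕ) + 1 + m = (f j).1 → v < j := by
  intro m
  induction m with
  | zero =>
    intro v h1 h2
    rcases hf.2.2.2.2.2 v j h1 hj.1 (by omega) with h | h
    · exact h
    · exact absurd h (hna v (by omega))
  | succ m ih =>
    intro v h1 h2
    have : ∀ d : ℕ, ∀ w : Fin n, ((f w).2 : ℕ) = 0 → ((f w).1 : ℕ) = (f v).1 + 1 + d →
        ∃ u, ((f u).2 : ℕ) = 0 ∧ ((f u).1 : ℕ) = (f v).1 + 1 := by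
      intro d
      induction d with
      | zero => intro w h1 h2; exact ⟨w, h1, h2⟩
      | succ d ih =>
        intro w h1 h2
        obtain ⟨u, hu, hu1⟩ := hf.2.2.2.1 w h1 (by omega)
        exact ih u hu (by omega)
    obtain ⟨u, hu, hu1⟩ := this (m + 1) j hj.1 (by omega)
    have huj := ih u hu (by omega)
    by_contra hc
    have hne : v ≠ j := by rintro rfl; omega
    have hjv : j < v := lt_of_le_of_ne (not_lt.mp hc) (Ne.symm hne)
    rcases hf.2.2.2.2.2 v u h1 hu (by omega) with h | h
    · exact absurd (h.trans huj) (not_lt.mpr hjv.le)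
    · exact hna v (by omega) (hG u j v huj hjv h.symm).2.symm

def rowSet {n : ℕ} (f : Fin n → Fin (n + 1) × Fin (n + 1)) (j : Fin n) : Finset (Fin n) :=
  Finset.univ.filter fun v => v = j ∨ ((f v).1 : ℕ) = 0

def colSet {n : ℕ} (f : Fin n → Fin (n + 1) × Fin (n + 1)) (j : Fin n) : Finset (Fin n) :=
  Finset.univ.filter fun v => v ≠ j ∧ ((f v).2 : ℕ) = 0

lemma mem_rowSet {n : ℕ} {f : Fin n → Fin (n + 1) × Fin (n + 1)} {j v : Fin n} :
    v ∈ rowSet f j ↔ v = j ∨ ((f v).1 : ℕ) = 0 := by simp [rowSet]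

lemma mem_colSet {n : ℕ} {f : Fin n → Fin (n + 1) × Fin (n + 1)} {j v : Fin n} :
    v ∈ colSet f j ↔ v ≠ j ∧ ((f v).2 : ℕ) = 0 := by simp [colSet]

lemma move_row {n : ℕ} {G : SimpleGraph (Fin n)}
    {f g : Fin n → Fin (n + 1) × Fin (n + 1)} (hf : IsHookTab G f) {j : Fin n}
    (h : LegToArm G f g j) (v : Fin n) : ((g v).1 : ℕ) = 0 ↔ v ∈ rowSet f j := by
  obtain ⟨hj, hj', hg, hreg, -⟩ := h
  rw [mem_rowSet]
  have h1 := hf.2.1 v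
  have h2 := hg.2.1 v
  by_cases e : v = j
  · subst e; simp [hj'.1]
  · have := hreg v e
    simp only [InArm, InLeg] at this
    grind

lemma move_col {n : ℕ} {G : SimpleGraph (Fin n)}
    {f g : Fin n → Fin (n + 1) × Fin (n + 1)} (hf : IsHookTab G f) {j : Fin n}
    (h : LegToArm G f g j) (v : Fin n) : ((g v).2 : ℕ) = 0 ↔ v ∈ colSet f j := by
  obtain ⟨hj, hj', hg, hreg, -⟩ := h
  rw [mem_colSet]
  have h1 := hf.2.1 v
  have h2 := hg.2.1 v
  by_cases e : v = j
  · subst e; simp [hj'.2]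
  · have := hreg v e
    simp only [InArm, InLeg] at this
    grind

lemma move_row_eq {n : ℕ} {G : SimpleGraph (Fin n)} (hG : IsNUIG G)
    {f g : Fin n → Fin (n + 1) × Fin (n + 1)} (hf : IsHookTab G f) {j : Fin n}
    (h : LegToArm G f g j) :
    ∀ v ∈ rowSet f j, ((g v).2 : ℕ) = rkOf (rowSet f j) (fun u => (u : ℕ)) v := by
  have hg := h.2.2.1
  have hr := move_row hf h
  refine eq_rkOf (rowSet f j) (fun u => (u : ℕ)) (fun v => ((g v).2 : ℕ)) ?_ ?_ ?_
  · intro u hu v hv e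
    exact hook_eq hg (((hr u).2 hu).trans ((hr v).2 hv).symm) e
  · intro u hu v hv
    exact row_lt_iff hG hg ((hr u).2 hu) ((hr v).2 hv)
  · intro v hv hpos
    obtain ⟨u, hu, hu1⟩ := hg.2.2.1 v ((hr v).2 hv) hpos
    exact ⟨u, (hr u).1 hu, hu1⟩

lemma move_col_eq {n : ℕ} {G : SimpleGraph (Fin n)}
    {f g : Fin n → Fin (n + 1) × Fin (n + 1)} (hf : IsHookTab G f) {j : Fin n}
    (h : LegToArm G f g j) :
    ∀ v ∈ colSet f j, ((g v).1 : ℕ) = rkOf (colSet f j) (fun u => ((f u).1 : ℕ)) v := by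
  have hg := h.2.2.1
  have hr := move_col hf h
  refine eq_rkOf (colSet f j) (fun u => ((f u).1 : ℕ)) (fun v => ((g v).1 : ℕ)) ?_ ?_ ?_
  · intro u hu v hv e
    exact hook_eq hg e (((hr u).2 hu).trans ((hr v).2 hv).symm)
  · intro u hu v hv
    have hu' := mem_colSet.1 hu
    have hv' := mem_colSet.1 hv
    have e1 := move_row hf h u
    have e2 := move_row hf h v
    rw [mem_rowSet] at e1 e2
    have := h.2.2.2.2.2.1 u v hu'.1 hv'.1
    simp only [InLeg] at this
    grind
  · intro v hv hpos
    obtain ⟨u, hu, hu1⟩ := hg.2.2.2.1 v ((hr v).2 hv) hpos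
    exact ⟨u, (hr u).1 hu, hu1⟩

lemma move_unique {n : ℕ} {G : SimpleGraph (Fin n)} (hG : IsNUIG G)
    {f g g' : Fin n → Fin (n + 1) × Fin (n + 1)} (hf : IsHookTab G f) {j : Fin n}
    (h : LegToArm G f g j) (h' : LegToArm G f g' j) : g = g' := by
  funext v
  have a1 := move_row hf h v
  have a2 := move_row hf h' v
  have a3 := move_col hf h v
  have a4 := move_col hf h' v
  have b1 := move_row_eq hG hf h v
  have b2 := move_row_eq hG hf h' v
  have b3 := move_col_eq hf h v
  have b4 := move_col_eq hf h' v
  have c1 := h.2.2.1.2.1 v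
  have c2 := h'.2.2.1.2.1 v
  apply Prod.ext
  · apply Fin.ext
    by_cases e : v ∈ colSet f j
    · rw [b3 e, b4 e]
    · have : v ∈ rowSet f j := by grind
      rw [a1.2 this, a2.2 this]
  · apply Fin.ext
    by_cases e : v ∈ rowSet f j
    · rw [b1 e, b2 e]
    · have : v ∈ colSet f j := by grind
      rw [a3.2 this, a4.2 this]

lemma move_nonadj {n : ℕ} {G : SimpleGraph (Fin n)} (hG : IsNUIG G)
    {f g : Fin n → Fin (n + 1) × Fin (n + 1)} (hf : IsHookTab G f) {j : Fin n}
    (h : LegToArm G f g j) (i : Fin n) (hi : ((f i).1 : ℕ) < ((f j).1 : ℕ)) :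
    ¬ G.Adj i j := by
  intro ha
  have hg := h.2.2.1
  have hinv := h.2.2.2.2.2.2
  have hj0 := h.2.1.1
  have hne : i ≠ j := ha.ne
  rcases lt_or_gt_of_ne hne with hlt | hgt
  · by_cases h0 : ((g i).1 : ℕ) = 0
    · exact row_nonadj hG hg h0 hj0 ha
    · have : (i, j) ∈ InvSet G g := by
        simp only [InvSet, Finset.mem_filter, Finset.mem_univ, true_and]
        exact ⟨hlt, ha, by omega⟩
      rw [hinv] at this
      simp only [InvSet, Finset.mem_filter, Finset.mem_univ, true_and] at this
      omega
  · have : (j, i) ∈ InvSet G f := by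
      simp only [InvSet, Finset.mem_filter, Finset.mem_univ, true_and]
      exact ⟨hgt, ha.symm, hi⟩
    rw [← hinv] at this
    simp only [InvSet, Finset.mem_filter, Finset.mem_univ, true_and] at this
    omega

/-- The tableau obtained by moving `j` to its sorted place in the first row. -/
def moveTab {n : ℕ} (f : Fin n → Fin (n + 1) × Fin (n + 1)) (j : Fin n) :
    Fin n → Fin (n + 1) × Fin (n + 1) := fun v =>
  (if v ∈ colSet f j then ⟨rkOf (colSet f j) (fun u => ((f u).1 : ℕ)) v, rkOf_le _ _ _⟩ else 0,
   if v ∈ rowSet f j then ⟨rkOf (rowSet f j) (fun u => (u : ℕ)) v, rkOf_le _ _ _⟩ else 0)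

lemma moveTab_fst {n : ℕ} (f : Fin n → Fin (n + 1) × Fin (n + 1)) (j v : Fin n) :
    ((moveTab f j v).1 : ℕ) =
      if v ∈ colSet f j then rkOf (colSet f j) (fun u => ((f u).1 : ℕ)) v else 0 := by
  unfold moveTab; split_ifs <;> simp

lemma moveTab_snd {n : ℕ} (f : Fin n → Fin (n + 1) × Fin (n + 1)) (j v : Fin n) :
    ((moveTab f j v).2 : ℕ) =
      if v ∈ rowSet f j then rkOf (rowSet f j) (fun u => (u : ℕ)) v else 0 := by
  unfold moveTab; split_ifs <;> simp

lemma move_exists {n : ℕ} {G : SimpleGraph (Fin n)} (hG : IsNUIG G)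
    {f : Fin n → Fin (n + 1) × Fin (n + 1)} (hf : IsHookTab G f) {j : Fin n}
    (hj : InLeg f j) (hna : ∀ i, ((f i).1 : ℕ) < ((f j).1 : ℕ) → ¬ G.Adj i j) :
    LegToArm G f (moveTab f j) j := by
  obtain ⟨c, hc1, hc2⟩ := col_exists hf _ j hj.1 rfl
  have hj1 := hj.1
  have hj2 := hj.2
  have hcj : c ≠ j := by rintro rfl; omega
  have hcC : c ∈ colSet f j := mem_colSet.2 ⟨hcj, hc2⟩
  have hcR : c ∈ rowSet f j := mem_rowSet.2 (Or.inr hc1)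
  have hjR : j ∈ rowSet f j := mem_rowSet.2 (Or.inl rfl)
  have hjC : j ∉ colSet f j := fun h => (mem_colSet.1 h).1 rfl
  have hcltj : c < j := above_lt hG hf hj hna ((f j).1 - 1) c hc2 (by omega)
  have hcmin : ∀ v ∈ rowSet f j, v ≠ c → c < v := by
    intro v hv hne
    rcases mem_rowSet.1 hv with rfl | h
    · exact hcltj
    · rw [← row_lt_iff hG hf hc1 h]
      by_contra hcon
      exact hne (hook_eq hf (by omega) (by omega))
  have hcorner : ∀ v, v ∈ rowSet f j → v ∈ colSet f j → v = c := by
    intro v h1 h2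
    rw [mem_rowSet] at h1
    rw [mem_colSet] at h2
    exact hook_eq hf (by grind) (by omega)
  have hcover : ∀ v, v ∈ rowSet f j ∨ v ∈ colSet f j := by
    intro v
    rw [mem_rowSet, mem_colSet]
    have := hf.2.1 v
    tauto
  set g := moveTab f j with hgdef
  have hcol0 : ∀ v, v ∈ colSet f j → ((g v).2 : ℕ) = 0 := by
    intro v hv
    rw [hgdef, moveTab_snd]
    split_ifs with h
    · have := hcorner v h hv
      subst this
      unfold rkOf
      rw [Finset.card_eq_zero, Finset.filter_eq_empty_iff]
      intro w hw hlt
      beta_reduce at hlt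
      rcases eq_or_ne w v with rfl | hne
      · omega
      · have := hcmin w hw hne
        simp only [Fin.lt_def] at this
        omega
    · rfl
  have hrow0 : ∀ v, v ∈ rowSet f j → ((g v).1 : ℕ) = 0 := by
    intro v hv
    rw [hgdef, moveTab_fst]
    split_ifs with h
    · have := hcorner v hv h
      subst this
      unfold rkOf
      rw [Finset.card_eq_zero, Finset.filter_eq_empty_iff]
      intro w hw hlt
      beta_reduce at hlt
      omega
    · rfl
  have hgr : ∀ v ∈ rowSet f j, ((g v).2 : ℕ) = rkOf (rowSet f j) (fun u => (u : ℕ)) v := by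
    intro v hv; rw [hgdef, moveTab_snd, if_pos hv]
  have hgc : ∀ v ∈ colSet f j,
      ((g v).1 : ℕ) = rkOf (colSet f j) (fun u => ((f u).1 : ℕ)) v := by
    intro v hv; rw [hgdef, moveTab_fst, if_pos hv]
  have hlr : ∀ u ∈ rowSet f j, ∀ v ∈ rowSet f j, ((g u).2 : ℕ) < (g v).2 ↔ u < v := by
    intro u hu v hv
    rw [hgr u hu, hgr v hv, rkOf_lt _ _ hu]; rfl
  have hlc : ∀ u ∈ colSet f j, ∀ v ∈ colSet f j,
      ((g u).1 : ℕ) < (g v).1 ↔ ((f u).1 : ℕ) < (f v).1 := by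
    intro u hu v hv
    rw [hgc u hu, hgc v hv, rkOf_lt _ _ hu]
  have hrow : ∀ v, ((g v).1 : ℕ) = 0 ↔ v ∈ rowSet f j := by
    intro v
    refine ⟨fun h => ?_, hrow0 v⟩
    rcases hcover v with h1 | h1
    · exact h1
    · have := hlc c hcC v h1
      rw [mem_rowSet]; right; omega
  have hcol : ∀ v, ((g v).2 : ℕ) = 0 ↔ v ∈ colSet f j := by
    intro v
    refine ⟨fun h => ?_, hcol0 v⟩
    rcases hcover v with h1 | h1
    · have h2 := hlr c hcR v h1
      by_cases e : v = c
      · rw [e]; exact hcC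
      · have := h2.2 (hcmin v h1 e)
        omega
    · exact h1
  have hRinj : ∀ u ∈ rowSet f j, ∀ v ∈ rowSet f j, ((g u).2 : ℕ) = (g v).2 → u = v := by
    intro u hu v hv e
    have h1 := hlr u hu v hv
    have h2 := hlr v hv u hu
    by_contra hne
    rcases lt_or_gt_of_ne hne with h | h
    · have := h1.2 h; omega
    · have := h2.2 h; omega
  have hCinj : ∀ u ∈ colSet f j, ∀ v ∈ colSet f j, ((g u).1 : ℕ) = (g v).1 → u = v := by
    intro u hu v hv e
    have h1 := hlc u hu v hv
    have h2 := hlc v hv u hu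
    have h3 := (mem_colSet.1 hu).2
    have h4 := (mem_colSet.1 hv).2
    exact hook_eq hf (by omega) (by omega)
  have hrowlt : ∀ u v, u ≠ j → v ≠ j →
      (((g u).1 : ℕ) < (g v).1 ↔ ((f u).1 : ℕ) < (f v).1) := by
    intro u v hu hv
    by_cases h1 : u ∈ colSet f j
    · by_cases h2 : v ∈ colSet f j
      · exact hlc u h1 v h2
      · have h3 := (hcover v).resolve_right h2
        have h4 := hrow0 v h3
        have h5 := (mem_rowSet.1 h3).resolve_left hv
        omega
    · have h3 := (hcover u).resolve_right h1
      have h4 := hrow0 u h3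
      have h5 := (mem_rowSet.1 h3).resolve_left hu
      have h6 := hrow v
      rw [mem_rowSet] at h6
      have h7 : ((g v).1 : ℕ) = 0 ↔ ((f v).1 : ℕ) = 0 := by tauto
      omega
  refine ⟨hj, ⟨hrow0 j hjR, fun h => hjC ((hcol j).1 h)⟩, ⟨?_, ?_, ?_, ?_, ?_, ?_⟩, ?_, ?_, ?_, ?_⟩
  · intro u v e
    have e1 : ((g u).1 : ℕ) = (g v).1 := by rw [e]
    have e2 : ((g u).2 : ℕ) = (g v).2 := by rw [e]
    rcases hcover u with h | h
    · have hv : v ∈ rowSet f j := by rw [← hrow, ← e1, hrow]; exact h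
      exact hRinj u h v hv e2
    · have hv : v ∈ colSet f j := by rw [← hcol, ← e2, hcol]; exact h
      exact hCinj u h v hv e1
  · intro v
    rw [hrow, hcol]; exact hcover v
  · intro v hv hpos
    rw [hrow] at hv
    rw [hgr v hv] at hpos
    obtain ⟨u, hu, hu1⟩ := rkOf_pred _ _ (fun a _ b _ e => Fin.ext e) hpos
    exact ⟨u, hrow0 u hu, by rw [hgr u hu, hgr v hv, hu1]⟩
  · intro v hv hpos
    rw [hcol] at hv
    rw [hgc v hv] at hpos
    obtain ⟨u, hu, hu1⟩ := rkOf_pred _ _ (fun a ha b hb e =>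
      hook_eq hf e ((mem_colSet.1 ha).2.trans (mem_colSet.1 hb).2.symm)) hpos
    exact ⟨u, hcol0 u hu, by rw [hgc u hu, hgc v hv, hu1]⟩
  · intro u v hu hv e
    rw [hrow] at hu hv
    have hlt : u < v := (hlr u hu v hv).1 (by omega)
    refine ⟨hlt, ?_⟩
    rcases mem_rowSet.1 hu with rfl | hu0
    · rcases mem_rowSet.1 hv with rfl | hv0
      · exact absurd hlt (lt_irrefl _)
      · exact fun h => hna v (by omega) h.symm
    · rcases mem_rowSet.1 hv with rfl | hv0
      · exact hna u (by omega)
      · exact row_nonadj hG hf hu0 hv0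
  · intro u v hu hv e
    rw [hcol] at hu hv
    have hlt : ((f u).1 : ℕ) < (f v).1 := (hlc u hu v hv).1 (by omega)
    have hbet : ∀ w ∈ colSet f j, ((f u).1 : ℕ) < (f w).1 → ((f w).1 : ℕ) < (f v).1 → False := by
      intro w hw h1 h2
      have := (hlc u hu w hw).2 h1
      have := (hlc w hw v hv).2 h2
      omega
    have hu0 := (mem_colSet.1 hu).2
    have hv0 := (mem_colSet.1 hv).2
    by_cases e1 : ((f v).1 : ℕ) = (f u).1 + 1
    · exact hf.2.2.2.2.2 u v hu0 hv0 e1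
    · obtain ⟨w, hw, hw1⟩ := hf.2.2.2.1 v hv0 (by omega)
      have hwj : w = j := by
        by_contra hne
        exact hbet w (mem_colSet.2 ⟨hne, hw⟩) (by omega) (by omega)
      subst hwj
      have huw : u < w := above_lt hG hf hj hna ((f w).1 - (f u).1 - 1) u hu0 (by omega)
      rcases lt_trichotomy u v with h | h | h
      · exact Or.inl h
      · subst h; omega
      · right
        rcases hf.2.2.2.2.2 w v hj1 hv0 (by omega) with h2 | h2
        · exact absurd (huw.trans h2) (not_lt.mpr h.le)
        · exact (hG v u w h huw h2.symm).1.symm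
  · intro u hu
    have h1 := hrow u
    have h2 := hcol u
    rw [mem_rowSet] at h1
    rw [mem_colSet] at h2
    simp only [InArm, InLeg]
    tauto
  · intro u u' hu hu' h h'
    rw [hlr u (mem_rowSet.2 (Or.inr h.1)) u' (mem_rowSet.2 (Or.inr h'.1))]
    exact row_lt_iff hG hf h.1 h'.1
  · intro u u' hu hu' h h'
    exact (hrowlt u u' hu hu').symm
  · ext ⟨a, b⟩
    simp only [InvSet, Finset.mem_filter, Finset.mem_univ, true_and]
    refine and_congr_right fun hab => and_congr_right fun hadj => ?_
    have hgj := hrow0 j hjR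
    by_cases ha : a = j
    · subst ha
      constructor
      · intro h; omega
      · intro h; exact absurd hadj.symm (hna b h)
    · by_cases hb : b = j
      · subst hb
        have h6 := hrow a
        rw [mem_rowSet] at h6
        have h7 : ¬ ((f a).1 : ℕ) < (f b).1 := fun h => hna a h hadj
        have h8 : ((f a).1 : ℕ) ≠ (f b).1 := by
          intro h8
          have := hf.2.1 a
          exact ha (hook_eq hf h8 (by omega))
        have h9 : ((g a).1 : ℕ) = 0 ↔ ((f a).1 : ℕ) = 0 := by tauto
        omega
      · exact hrowlt b a hb ha

/-- in a hook `G`-tableau, (a) a leg entry `j` is movable iff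
it is non-adjacent to every entry in a row above it; (b) if `j` is movable then
its target position in the arm is unique, and every leg entry above `j` is
smaller than `j`. -/
theorem stmt12 (n : ℕ) (G : SimpleGraph (Fin n)) (hG : IsNUIG G)
    (f : Fin n → Fin (n + 1) × Fin (n + 1)) (hf : IsHookTab G f)
    (j : Fin n) (hj : InLeg f j) :
    ((∃ g, LegToArm G f g j) ↔
      ∀ i, ((f i).1 : ℕ) < ((f j).1 : ℕ) → ¬ G.Adj i j) ∧
    ((∃ g, LegToArm G f g j) →
      (∀ g g', LegToArm G f g j → LegToArm G f g' j → g = g') ∧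
      (∀ i, InLeg f i → ((f i).1 : ℕ) < ((f j).1 : ℕ) → i < j)) := by
  refine ⟨⟨fun ⟨g, hg⟩ i hi => move_nonadj hG hf hg i hi,
    fun h => ⟨_, move_exists hG hf hj h⟩⟩, ?_⟩
  rintro ⟨g, hg⟩
  refine ⟨fun g g' h h' => move_unique hG hf h h', fun i hi hlt => ?_⟩
  exact above_lt hG hf hj (move_nonadj hG hf hg) ((f j).1 - (f i).1 - 1) i hi.1 (by omega)
end

section
/- Let G be a natural unit interval graph on {1,…,n} and let T be a G-tableau of hook shape. Then every entry in the arm of T is movable, and each such entry can be moved to a unique position in the leg. -/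
open Finset
open scoped Classical

/-- Hook tableau conditions in terms of natural-number valued row and column functions. -/
structure HkAux {n : ℕ} (G : SimpleGraph (Fin n)) (r c : Fin n → ℕ) : Prop where
  inj : ∀ u v, r u = r v → c u = c v → u = v
  rc : ∀ v, r v = 0 ∨ c v = 0
  row : ∀ v, r v = 0 → 0 < c v → ∃ u, r u = 0 ∧ c u + 1 = c v
  col : ∀ v, c v = 0 → 0 < r v → ∃ u, c u = 0 ∧ r u + 1 = r v
  c1 : ∀ u v, r u = 0 → r v = 0 → c v = c u + 1 → u < v ∧ ¬ G.Adj u v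
  c2 : ∀ u v, c u = 0 → c v = 0 → r v = r u + 1 → u < v ∨ G.Adj u v

theorem hkAux_iff {n : ℕ} (G : SimpleGraph (Fin n)) (f : Fin n → Fin (n + 1) × Fin (n + 1)) :
    IsHookTab G f ↔ HkAux G (fun v => ((f v).1 : ℕ)) (fun v => ((f v).2 : ℕ)) := by
  constructor
  · rintro ⟨h1, h2, h3, h4, h5, h6⟩
    exact ⟨fun u v a b => h1 (Prod.ext (Fin.ext a) (Fin.ext b)), h2, h3, h4, h5, h6⟩
  · rintro ⟨h1, h2, h3, h4, h5, h6⟩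
    exact ⟨fun u v a => h1 u v (by simp [a]) (by simp [a]), h2, h3, h4, h5, h6⟩

/-- Downward closedness of a labelled set. -/
theorem down_aux {V : Type*} (S : V → Prop) (h : V → ℕ)
    (hd : ∀ v, S v → 0 < h v → ∃ u, S u ∧ h u + 1 = h v) (v : V) (hv : S v) (k : ℕ)
    (hk : k ≤ h v) : ∃ u, S u ∧ h u = k := by
  obtain ⟨d, hd'⟩ : ∃ d, h v = k + d := ⟨h v - k, by omega⟩
  induction d generalizing v with
  | zero => exact ⟨v, hv, by omega⟩
  | succ d ih =>
    obtain ⟨u, hu, hu'⟩ := hd v hv (by omega)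
    exact ih u hu (by omega) (by omega)

theorem card_aux {V : Type*} [Fintype V] (S : V → Prop) (h : V → ℕ)
    (hd : ∀ v, S v → 0 < h v → ∃ u, S u ∧ h u + 1 = h v)
    (hi : ∀ u v, S u → S v → h u = h v → u = v) (v : V) (hv : S v) :
    h v = (Finset.univ.filter fun w => S w ∧ h w < h v).card := by
  have : (Finset.univ.filter fun w => S w ∧ h w < h v).image h = Finset.range (h v) := by
    ext k
    simp only [Finset.mem_image, Finset.mem_filter, Finset.mem_univ, true_and, Finset.mem_range]
    constructor
    · rintro ⟨a, ⟨_, h2⟩, rfl⟩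
      exact h2
    · intro hk
      obtain ⟨u, hu, hu'⟩ := down_aux S h hd v hv k hk.le
      exact ⟨u, ⟨hu, by omega⟩, hu'⟩
  rw [← Finset.card_image_of_injOn (f := h), this, Finset.card_range]
  intro a ha b hb hab
  simp at ha hb
  exact hi a b ha.1 hb.1 hab

theorem le_aux {V : Type*} [Fintype V] (S : V → Prop) (h h' : V → ℕ)
    (hd : ∀ v, S v → 0 < h v → ∃ u, S u ∧ h u + 1 = h v)
    (hi : ∀ u v, S u → S v → h u = h v → u = v)
    (hd' : ∀ v, S v → 0 < h' v → ∃ u, S u ∧ h' u + 1 = h' v)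
    (hi' : ∀ u v, S u → S v → h' u = h' v → u = v)
    (hh : ∀ u v, S u → S v → (h u < h v ↔ h' u < h' v))
    (v : V) (hv : S v) : h v = h' v := by
  rw [card_aux S h hd hi v hv, card_aux S h' hd' hi' v hv]
  congr 1
  ext w
  simp only [Finset.mem_filter, Finset.mem_univ, true_and]
  constructor
  · rintro ⟨a, b⟩
    exact ⟨a, (hh _ _ a hv).1 b⟩
  · rintro ⟨a, b⟩
    exact ⟨a, (hh _ _ a hv).2 b⟩

theorem lt_aux {n : ℕ} (S : Fin n → Prop) (h : Fin n → ℕ)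
    (hd : ∀ v, S v → 0 < h v → ∃ u, S u ∧ h u + 1 = h v) (v : Fin n) (hv : S v) : h v < n := by
  have : Finset.range (h v + 1) ⊆ Finset.univ.image h := by
    intro k hk
    obtain ⟨u, _, hu'⟩ := down_aux S h hd v hv k (by simpa [Nat.lt_succ_iff] using hk)
    simp only [Finset.mem_image, Finset.mem_univ, true_and]
    exact ⟨u, hu'⟩
  have h2 := (Finset.card_le_card this).trans Finset.card_image_le
  simp at h2
  omega

section HkLemmas

variable {n : ℕ} {G : SimpleGraph (Fin n)} {r c : Fin n → ℕ}

/-- First-row entries increase and are pairwise non-adjacent. -/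
theorem HkAux.row_lt (hG : IsNUIG G) (H : HkAux G r c) (u v : Fin n) (hu : r u = 0)
    (hv : r v = 0) (huv : c u < c v) : u < v ∧ ¬ G.Adj u v := by
  obtain ⟨d, hd⟩ : ∃ d, c v = c u + 1 + d := ⟨c v - c u - 1, by omega⟩
  induction d generalizing v with
  | zero => exact H.c1 u v hu hv (by omega)
  | succ d ih =>
    obtain ⟨w, hw, hw'⟩ := H.row v hv (by omega)
    obtain ⟨h1, h2⟩ := ih w hw (by omega) (by omega)
    obtain ⟨h3, _⟩ := H.c1 w v hw hv (by omega)
    exact ⟨h1.trans h3, fun h => h2 (hG u w v h1 h3 h).1⟩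

/-- The region strictly above the moved entry, described via the original tableau. -/
def AboveAux (G : SimpleGraph (Fin n)) (r c : Fin n → ℕ) (j u : Fin n) : Prop :=
  ∀ w, c w = 0 → r w ≤ r u → w < j ∧ ¬ G.Adj w j

/-- The move conditions, in natural-number form. -/
structure MvAux (G : SimpleGraph (Fin n)) (r c r' c' : Fin n → ℕ) (j : Fin n) : Prop where
  hk : HkAux G r' c'
  jr : r' j ≠ 0
  jc : c' j = 0
  zr : ∀ u, u ≠ j → (r u = 0 ↔ r' u = 0)
  zc : ∀ u, u ≠ j → (c u = 0 ↔ c' u = 0)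
  oc : ∀ u u', u ≠ j → u' ≠ j → r u = 0 → r u' = 0 → (c u < c u' ↔ c' u < c' u')
  or : ∀ u u', u ≠ j → u' ≠ j → c u = 0 → c u' = 0 → (r u < r u' ↔ r' u < r' u')
  inv : ∀ u v, u < v → G.Adj u v → (r' v < r' u ↔ r v < r u)

theorem MvAux.above_iff (hG : IsNUIG G) (H : HkAux G r c) {r' c' : Fin n → ℕ} {j : Fin n}
    (hj : r j = 0) (hj' : c j ≠ 0) (M : MvAux G r c r' c' j) (u : Fin n) (hu : c u = 0) :
    r' u < r' j ↔ AboveAux G r c j u := by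
  have K := M.hk
  have hne : ∀ w, c w = 0 → w ≠ j := fun w hw h => hj' (h ▸ hw)
  have nadj : ∀ w, c w = 0 → r' w < r' j → ¬ G.Adj w j := by
    intro w hw hlt hadj
    rcases lt_trichotomy w j with h | h | h
    · by_cases h0 : r w = 0
      · exact (H.row_lt hG w j h0 hj (by omega)).2 hadj
      · have := (M.inv w j h hadj).2 (by omega)
        omega
    · exact hne w hw h
    · have := (M.inv j w h hadj.symm).1 hlt
      omega
  constructor
  · intro hlt
    have key : ∀ k w, c w = 0 → r' w + k + 1 = r' j → w < j ∧ ¬ G.Adj w j := by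
      intro k
      induction k with
      | zero =>
        intro w hw hk
        have h1 := nadj w hw (by omega)
        have h2 := K.c2 w j ((M.zc w (hne w hw)).1 hw) M.jc (by omega)
        exact ⟨h2.resolve_right h1, h1⟩
      | succ k ih =>
        intro w hw hk
        have h1 := nadj w hw (by omega)
        obtain ⟨x, hx, hx'⟩ := down_aux (fun v => c' v = 0) r' K.col j M.jc (r' w + 1) (by omega)
        have hxj : x ≠ j := by
          rintro rfl
          omega
        have hx0 := (M.zc x hxj).2 hx
        obtain ⟨h3, h4⟩ := ih x hx0 (by omega)
        refine ⟨?_, h1⟩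
        have h2 := K.c2 w x ((M.zc w (hne w hw)).1 hw) hx hx'
        by_contra hcon
        have hjw : j < w := lt_of_le_of_ne (not_lt.1 hcon) (hne w hw).symm
        rcases h2 with h2 | h2
        · exact absurd (hjw.trans h2) (not_lt.2 h3.le)
        · exact h4 (hG x j w h3 hjw h2.symm).1
    intro w hw hwu
    have := M.or u w (hne u hu) (hne w hw) hu hw
    exact key (r' j - r' w - 1) w hw (by omega)
  · intro hA
    by_contra hcon
    have hu' := (M.zc u (hne u hu)).1 hu
    have h1 : r' u ≠ r' j := fun h => hne u hu (K.inj u j h (by rw [hu', M.jc]))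
    obtain ⟨x, hx, hx'⟩ := down_aux (fun v => c' v = 0) r' K.col u hu' (r' j + 1) (by omega)
    have hxj : x ≠ j := by
      rintro rfl
      omega
    have hx0 := (M.zc x hxj).2 hx
    have h2 := M.or u x (hne u hu) hxj hu hx0
    obtain ⟨h3, h4⟩ := hA x hx0 (by omega)
    rcases K.c2 j x M.jc hx hx' with h | h
    · exact absurd h3 (not_lt.2 h.le)
    · exact h4 h.symm

theorem MvAux.unique (hG : IsNUIG G) (H : HkAux G r c) {r1 c1 r2 c2 : Fin n → ℕ} {j : Fin n}
    (hj : r j = 0) (hj' : c j ≠ 0) (M1 : MvAux G r c r1 c1 j) (M2 : MvAux G r c r2 c2 j)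
    (v : Fin n) : r1 v = r2 v ∧ c1 v = c2 v := by
  have zc : ∀ u, c1 u = 0 ↔ c2 u = 0 := by
    intro u
    by_cases h : u = j
    · subst h
      simp [M1.jc, M2.jc]
    · rw [← M1.zc u h, ← M2.zc u h]
  have zr : ∀ u, r1 u = 0 ↔ r2 u = 0 := by
    intro u
    by_cases h : u = j
    · subst h
      simp [M1.jr, M2.jr]
    · rw [← M1.zr u h, ← M2.zr u h]
  have hr : ∀ v, c1 v = 0 → r1 v = r2 v := by
    intro v hv
    refine le_aux (fun v => c1 v = 0) r1 r2 M1.hk.col ?_ ?_ ?_ ?_ v hv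
    · intro u v hu hv h
      exact M1.hk.inj u v h (hu.trans hv.symm)
    · simp only [zc]
      exact M2.hk.col
    · intro u v hu hv h
      rw [zc] at hu hv
      exact M2.hk.inj u v h (hu.trans hv.symm)
    · intro u v hu hv
      have ne1 : ∀ u, u ≠ j → c1 u = 0 → r1 u ≠ r1 j := fun u h h' e =>
        h (M1.hk.inj u j e (by rw [h', M1.jc]))
      have ne2 : ∀ u, u ≠ j → c1 u = 0 → r2 u ≠ r2 j := fun u h h' e =>
        h (M2.hk.inj u j e (by rw [(zc u).1 h', M2.jc]))
      by_cases h1 : u = j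
      · by_cases h2 : v = j
        · simp [h1, h2]
        · subst h1
          have e1 := M1.above_iff hG H hj hj' v ((M1.zc v h2).2 hv)
          have e2 := M2.above_iff hG H hj hj' v ((M1.zc v h2).2 hv)
          have := ne1 v h2 hv
          have := ne2 v h2 hv
          have e3 := e1.trans e2.symm
          omega
      · by_cases h2 : v = j
        · subst h2
          have e1 := M1.above_iff hG H hj hj' u ((M1.zc u h1).2 hu)
          have e2 := M2.above_iff hG H hj hj' u ((M1.zc u h1).2 hu)
          exact e1.trans e2.symm
        · have hu' := (M1.zc u h1).2 hu
          have hv' := (M1.zc v h2).2 hv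
          rw [← M1.or u v h1 h2 hu' hv', ← M2.or u v h1 h2 hu' hv']
  have hc : ∀ v, r1 v = 0 → c1 v = c2 v := by
    intro v hv
    refine le_aux (fun v => r1 v = 0) c1 c2 M1.hk.row ?_ ?_ ?_ ?_ v hv
    · intro u v hu hv h
      exact M1.hk.inj u v (hu.trans hv.symm) h
    · simp only [zr]
      exact M2.hk.row
    · intro u v hu hv h
      rw [zr] at hu hv
      exact M2.hk.inj u v (hu.trans hv.symm) h
    · intro u v hu hv
      have h1 : u ≠ j := by
        rintro rfl
        exact M1.jr hu
      have h2 : v ≠ j := by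
        rintro rfl
        exact M1.jr hv
      have hu' := (M1.zr u h1).2 hu
      have hv' := (M1.zr v h2).2 hv
      rw [← M1.oc u v h1 h2 hu' hv', ← M2.oc u v h1 h2 hu' hv']
  have a1 := M1.hk.rc v
  have a2 := M2.hk.rc v
  have a3 := hr v
  have a4 := hc v
  have a5 := zr v
  have a6 := zc v
  omega

theorem mvAux_exists (hG : IsNUIG G) (H : HkAux G r c) {j : Fin n}
    (hj : r j = 0) (hj' : c j ≠ 0) :
    ∃ r' c', MvAux G r c r' c' j ∧ (∀ v, r' v ≤ n) ∧ ∀ v, c' v ≤ n := by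
  have hne : ∀ w, c w = 0 → w ≠ j := fun w hw h => hj' (h ▸ hw)
  have hrn : ∀ v, c v = 0 → r v < n := lt_aux (fun v => c v = 0) r H.col
  have hcn : ∀ v, r v = 0 → c v < n := lt_aux (fun v => r v = 0) c H.row
  have hex : ∃ p, ¬ ∃ w, c w = 0 ∧ r w = p ∧ w < j ∧ ¬ G.Adj w j := by
    refine ⟨n, ?_⟩
    rintro ⟨w, hw, hw', _⟩
    have := hrn w hw
    omega
  obtain ⟨p, hp, hmin⟩ : ∃ p, (¬ ∃ w, c w = 0 ∧ r w = p ∧ w < j ∧ ¬ G.Adj w j) ∧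
      ∀ q < p, ∃ w, c w = 0 ∧ r w = q ∧ w < j ∧ ¬ G.Adj w j :=
    ⟨Nat.find hex, Nat.find_spec hex, fun q hq => not_not.1 (Nat.find_min hex hq)⟩
  obtain ⟨c0, hc0, hc0'⟩ := down_aux (fun v => r v = 0) c H.row j hj 0 (by omega)
  have hp0 : 0 < p := by
    rcases Nat.eq_zero_or_pos p with h | h
    · exact absurd ⟨c0, hc0', by omega, H.row_lt hG c0 j hc0 hj (by omega)⟩ hp
    · exact h
  have hpn : p ≤ n := by
    obtain ⟨w, hw, hw', _⟩ := hmin (p - 1) (by omega)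
    have := hrn w hw
    omega
  have hab : ∀ w, c w = 0 → r w < p → w < j ∧ ¬ G.Adj w j := by
    intro w hw hlt
    obtain ⟨x, hx, hx', h⟩ := hmin _ hlt
    have : x = w := H.inj x w hx' (by omega)
    exact this ▸ h
  have hat : ∀ w, c w = 0 → r w = p → j < w ∨ G.Adj j w := by
    intro w hw he
    by_contra hcon
    push Not at hcon
    exact hp ⟨w, hw, he, lt_of_le_of_ne hcon.1 (hne w hw), fun h => hcon.2 h.symm⟩
  have hrow : ∀ w, r w = 0 → ¬ G.Adj w j := by
    intro w hw hadj
    rcases lt_trichotomy (c w) (c j) with h | h | h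
    · exact (H.row_lt hG w j hw hj h).2 hadj
    · exact hadj.ne (H.inj w j (by omega) h)
    · exact (H.row_lt hG j w hj hw h).2 hadj.symm
  obtain ⟨r', hr'⟩ : ∃ r' : Fin n → ℕ, ∀ u, (u = j → r' u = p) ∧ (u ≠ j → c u ≠ 0 → r' u = 0) ∧
      (c u = 0 → r u < p → r' u = r u) ∧ (c u = 0 → p ≤ r u → r' u = r u + 1) := by
    refine ⟨fun u => if u = j then p else if c u ≠ 0 then 0 else if r u < p then r u else r u + 1,
      fun u => ⟨?_, ?_, ?_, ?_⟩⟩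
    · intro h; simp [h]
    · intro h h'; simp [h, h']
    · intro h h'; simp [h, h', hne u h]
    · intro h h'; simp [h, hne u h]; omega
  obtain ⟨c', hc'⟩ : ∃ c' : Fin n → ℕ, ∀ u, (u = j → c' u = 0) ∧
      (u ≠ j → c u < c j → c' u = c u) ∧ (u ≠ j → c j ≤ c u → c' u = c u - 1) := by
    refine ⟨fun u => if u = j then 0 else if c u < c j then c u else c u - 1,
      fun u => ⟨?_, ?_, ?_⟩⟩
    · intro h; simp [h]
    · intro h h'; simp [h, h']
    · intro h h'; simp [h, not_lt.2 h']
  have hrj := (hr' j).1 rfl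
  have hcj := (hc' j).1 rfl
  have ncj : ∀ u, u ≠ j → r u = 0 → c u ≠ c j := fun u h h1 h2 => h (H.inj u j (by omega) h2)
  -- basic facts on non-moved entries
  have zr : ∀ u, u ≠ j → (r u = 0 ↔ r' u = 0) := by
    intro u hu
    have := hr' u
    have := H.rc u
    by_cases h : c u = 0 <;> by_cases h' : r u < p <;> simp_all <;> omega
  have zc : ∀ u, u ≠ j → (c u = 0 ↔ c' u = 0) := by
    intro u hu
    have := hc' u
    have h1 := H.rc u
    have h2 := ncj u hu
    by_cases h : c u < c j
    · have := this.2.1 hu h; omega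
    · have := this.2.2 hu (by omega); omega
  have or : ∀ u u', u ≠ j → u' ≠ j → c u = 0 → c u' = 0 → (r u < r u' ↔ r' u < r' u') := by
    intro u v hu hv h1 h2
    have a1 := (hr' u).2.2.1 h1
    have a2 := (hr' u).2.2.2 h1
    have a3 := (hr' v).2.2.1 h2
    have a4 := (hr' v).2.2.2 h2
    omega
  have oc : ∀ u u', u ≠ j → u' ≠ j → r u = 0 → r u' = 0 → (c u < c u' ↔ c' u < c' u') := by
    intro u v hu hv h1 h2
    have a1 := (hc' u).2.1 hu
    have a2 := (hc' u).2.2 hu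
    have a3 := (hc' v).2.1 hv
    have a4 := (hc' v).2.2 hv
    have := ncj u hu h1
    have := ncj v hv h2
    omega
  have nrp : ∀ u, u ≠ j → c u = 0 → r' u ≠ p := by
    intro u hu h1
    have a1 := (hr' u).2.2.1 h1
    have a2 := (hr' u).2.2.2 h1
    omega
  have hk : HkAux G r' c' := by
    refine ⟨?_, ?_, ?_, ?_, ?_, ?_⟩
    · intro u v h1 h2
      by_cases hu : u = j
      · by_cases hv : v = j
        · rw [hu, hv]
        · subst hu
          have := (zc v hv).2 (by omega)
          exact absurd (by omega) (nrp v hv this)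
      · by_cases hv : v = j
        · subst hv
          have := (zc u hu).2 (by omega)
          exact absurd (by omega) (nrp u hu this)
        · have b1 := zr u hu
          have b2 := zr v hv
          have b3 := zc u hu
          have b4 := zc v hv
          have b5 := H.rc u
          have b6 := H.rc v
          have b7 := oc u v hu hv
          have b8 := oc v u hv hu
          have b9 := or u v hu hv
          have b0 := or v u hv hu
          apply H.inj <;> omega
    · intro v
      by_cases hv : v = j
      · subst hv
        exact Or.inr hcj
      · rw [← zr v hv, ← zc v hv]
        exact H.rc v
    · intro v h1 h2
      have hv : v ≠ j := by
        rintro rfl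
        omega
      have h1' := (zr v hv).2 h1
      have a1 := (hc' v).2.1 hv
      have a2 := (hc' v).2.2 hv
      have a3 := ncj v hv h1'
      obtain ⟨u, hu, hu'⟩ := H.row v h1' (by omega)
      by_cases huj : u = j
      · subst huj
        obtain ⟨w, hw, hw'⟩ := H.row u hu (by omega)
        have hwj : w ≠ u := by
          rintro rfl
          omega
        refine ⟨w, (zr w hwj).1 hw, ?_⟩
        have := (hc' w).2.1 hwj
        omega
      · refine ⟨u, (zr u huj).1 hu, ?_⟩
        have b1 := (hc' u).2.1 huj
        have b2 := (hc' u).2.2 huj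
        have b3 := ncj u huj hu
        omega
    · intro v h1 h2
      by_cases hv : v = j
      · subst hv
        obtain ⟨w, hw, hw', _⟩ := hmin (p - 1) (by omega)
        refine ⟨w, (zc w (hne w hw)).1 hw, ?_⟩
        have := (hr' w).2.2.1 hw
        omega
      · have h1' := (zc v hv).2 h1
        have a1 := (hr' v).2.2.1 h1'
        have a2 := (hr' v).2.2.2 h1'
        by_cases h3 : r v = p
        · exact ⟨j, hcj, by omega⟩
        · obtain ⟨u, hu, hu'⟩ := H.col v h1' (by omega)
          refine ⟨u, (zc u (hne u hu)).1 hu, ?_⟩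
          have b1 := (hr' u).2.2.1 hu
          have b2 := (hr' u).2.2.2 hu
          omega
    · intro u v h1 h2 h3
      have hu : u ≠ j := by
        rintro rfl
        omega
      have hv : v ≠ j := by
        rintro rfl
        omega
      exact H.row_lt hG u v ((zr u hu).2 h1) ((zr v hv).2 h2)
        ((oc u v hu hv ((zr u hu).2 h1) ((zr v hv).2 h2)).2 (by omega))
    · intro u v h1 h2 h3
      by_cases hu : u = j
      · by_cases hv : v = j
        · subst hu
          subst hv
          omega
        · subst hu
          have hv' := (zc v hv).2 h2
          have a1 := (hr' v).2.2.1 hv'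
          have a2 := (hr' v).2.2.2 hv'
          exact hat v hv' (by omega)
      · have hu' := (zc u hu).2 h1
        have a1 := (hr' u).2.2.1 hu'
        have a2 := (hr' u).2.2.2 hu'
        by_cases hv : v = j
        · subst hv
          exact Or.inl (hab u hu' (by omega)).1
        · have hv' := (zc v hv).2 h2
          have b1 := (hr' v).2.2.1 hv'
          have b2 := (hr' v).2.2.2 hv'
          have := nrp u hu hu'
          have := nrp v hv hv'
          exact H.c2 u v hu' hv' (by omega)
  refine ⟨r', c', ⟨hk, by omega, hcj, zr, zc, oc, or, ?_⟩, ?_, ?_⟩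
  · -- inversions
    have hnb : ∀ u, G.Adj u j → c u = 0 ∧ r u ≠ 0 ∧ p < r' u := by
      intro u hadj
      have h1 : r u ≠ 0 := fun h => hrow u h hadj
      have h2 : c u = 0 := (H.rc u).resolve_left h1
      have a1 := (hr' u).2.2.1 h2
      have a2 := (hr' u).2.2.2 h2
      have a3 : ¬ r u < p := fun h => (hab u h2 h).2 hadj
      exact ⟨h2, h1, by omega⟩
    intro u v huv hadj
    by_cases hu : u = j
    · subst hu
      have := hnb v hadj.symm
      omega
    · by_cases hv : v = j
      · subst hv
        have := hnb u hadj
        omega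
      · have b1 := zr u hu
        have b2 := zr v hv
        have b5 := H.rc u
        have b6 := H.rc v
        have b0 := or v u hv hu
        omega
  · intro v
    by_cases hv : v = j
    · subst hv
      omega
    · have a0 := (hr' v).2.1 hv
      have a1 := (hr' v).2.2.1
      have a2 := (hr' v).2.2.2
      have a3 := hrn v
      omega
  · intro v
    by_cases hv : v = j
    · subst hv
      omega
    · have a1 := (hc' v).2.1 hv
      have a2 := (hc' v).2.2 hv
      have a3 := hcn v
      have := H.rc v
      omega

end HkLemmas

theorem armToLeg_iff {n : ℕ} {G : SimpleGraph (Fin n)}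
    {f : Fin n → Fin (n + 1) × Fin (n + 1)} (hf : IsHookTab G f)
    {j : Fin n} (hj : InArm f j) (g : Fin n → Fin (n + 1) × Fin (n + 1)) :
    ArmToLeg G f g j ↔ MvAux G (fun v => ((f v).1 : ℕ)) (fun v => ((f v).2 : ℕ))
      (fun v => ((g v).1 : ℕ)) (fun v => ((g v).2 : ℕ)) j := by
  have hinv : InvSet G g = InvSet G f ↔ ∀ u v, u < v → G.Adj u v →
      (((g v).1 : ℕ) < ((g u).1 : ℕ) ↔ ((f v).1 : ℕ) < ((f u).1 : ℕ)) := by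
    rw [Finset.ext_iff]
    simp only [InvSet, Finset.mem_filter, Finset.mem_univ, true_and, Prod.forall]
    constructor
    · intro h u v h1 h2
      have := h u v
      tauto
    · intro h u v
      have := h u v
      tauto
  have F := (hkAux_iff G f).1 hf
  constructor
  · rintro ⟨_, ⟨h2, h3⟩, h4, h5, h6, h7, h8⟩
    have K := (hkAux_iff G g).1 h4
    have zr : ∀ u, u ≠ j → (((f u).1 : ℕ) = 0 ↔ ((g u).1 : ℕ) = 0) := by
      intro u hu
      have a := (h5 u hu).2
      have b := F.rc u
      have d := K.rc u
      unfold InLeg at a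
      beta_reduce at b d
      omega
    have zc : ∀ u, u ≠ j → (((f u).2 : ℕ) = 0 ↔ ((g u).2 : ℕ) = 0) := by
      intro u hu
      have a := (h5 u hu).1
      have b := F.rc u
      have d := K.rc u
      unfold InArm at a
      beta_reduce at b d
      omega
    refine ⟨K, h3, h2, zr, zc, ?_, ?_, hinv.1 h8⟩
    · intro u v hu hv a b
      have e := h6 u v hu hv
      have e1 := zc u hu
      have e2 := zc v hv
      unfold InArm at e
      beta_reduce at a b ⊢
      omega
    · intro u v hu hv a b
      have e := h7 u v hu hv
      have e1 := zr u hu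
      have e2 := zr v hv
      unfold InLeg at e
      beta_reduce at a b ⊢
      omega
  · intro M
    refine ⟨hj, ⟨M.jc, M.jr⟩, (hkAux_iff G g).2 M.hk, ?_, ?_, ?_, hinv.2 M.inv⟩
    · intro u hu
      have a := M.zr u hu
      have b := M.zc u hu
      unfold InArm InLeg
      beta_reduce at a b
      omega
    · intro u v hu hv a b
      exact M.oc u v hu hv a.1 b.1
    · intro u v hu hv a b
      exact M.or u v hu hv a.1 b.1

/-- in a hook `G`-tableau, every arm entry is movable, and can
be moved to a unique position in the leg. -/
theorem stmt13 (n : ℕ) (G : SimpleGraph (Fin n)) (hG : IsNUIG G)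
    (f : Fin n → Fin (n + 1) × Fin (n + 1)) (hf : IsHookTab G f)
    (j : Fin n) (hj : InArm f j) :
    ∃! g, ArmToLeg G f g j := by
  have H := (hkAux_iff G f).1 hf
  obtain ⟨r', c', M, hr, hc⟩ := mvAux_exists hG H hj.1 hj.2
  refine ⟨fun v => (⟨r' v, Nat.lt_succ_of_le (hr v)⟩, ⟨c' v, Nat.lt_succ_of_le (hc v)⟩),
    (armToLeg_iff hf hj _).2 M, ?_⟩
  intro g hg
  funext v
  have h := MvAux.unique hG H hj.1 hj.2 ((armToLeg_iff hf hj g).1 hg) M v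
  exact Prod.ext (Fin.ext h.1) (Fin.ext h.2)
end
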